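/- arXiv:2205.11415 — 12 statements merged into one kernel-verified Lean document; each statement's English description precedes it below -/
import Mathlib

section
/- The group E(ℚ) of rational points of E contains a point of order 4 if and only if one of the following holds: (i) (k₁−k₃)(k₂−k₄) and (k₁−k₂)(k₃−k₄) are both squares in ℚ; or (ii) (k₂−k₃)(k₁−k₄) and (k₁−k₂)(k₄−k₃) are both squares in ℚ; or (iii) (k₃−k₂)(k₁−k₄) and (k₁−k₃)(k₄−k₂) are both squares in ℚ. -/
namespace WeierstrassCurve.Affine

variable {F : Type*} [Field F]

/-- The 2-division polynomial of `W` is `4 (x - e₁) (x - e₂) (x - e₃)`. -/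
structure TwoTorsionSplits (W : Affine F) (e₁ e₂ e₃ : F) : Prop where
  b₂_eq : W.a₁ ^ 2 + 4 * W.a₂ = -4 * (e₁ + e₂ + e₃)
  b₄_eq : 2 * W.a₄ + W.a₁ * W.a₃ = 2 * (e₁ * e₂ + e₁ * e₃ + e₂ * e₃)
  b₆_eq : W.a₃ ^ 2 + 4 * W.a₆ = -4 * (e₁ * e₂ * e₃)

lemma four_ne_zero_of_two_ne_zero [NeZero (2 : F)] : (4 : F) ≠ 0 := by
  rw [show (4 : F) = 2 * 2 by norm_num]
  exact mul_ne_zero two_ne_zero two_ne_zero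

namespace TwoTorsionSplits

variable {W : Affine F} {e₁ e₂ e₃ : F}

lemma rotate (h : W.TwoTorsionSplits e₁ e₂ e₃) : W.TwoTorsionSplits e₂ e₃ e₁ where
  b₂_eq := by linear_combination h.b₂_eq
  b₄_eq := by linear_combination h.b₄_eq
  b₆_eq := by linear_combination h.b₆_eq

lemma equation_iff [NeZero (2 : F)] (h : W.TwoTorsionSplits e₁ e₂ e₃) (x y : F) :
    W.Equation x y ↔
      (2 * y + W.a₁ * x + W.a₃) ^ 2 = 4 * ((x - e₁) * (x - e₂) * (x - e₃)) := by
  have h4 : (4 : F) ≠ 0 := four_ne_zero_of_two_ne_zero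
  rw [Affine.equation_iff, ← mul_right_inj' h4]
  constructor <;> intro he
  · linear_combination he + x ^ 2 * h.b₂_eq + 2 * x * h.b₄_eq + h.b₆_eq
  · linear_combination he - x ^ 2 * h.b₂_eq - 2 * x * h.b₄_eq - h.b₆_eq

lemma sq_mul_addX_self_sub [NeZero (2 : F)] [DecidableEq F] (h : W.TwoTorsionSplits e₁ e₂ e₃)
    {x y : F} (he : W.Equation x y) (hy : y ≠ W.negY x y) :
    (2 * y + W.a₁ * x + W.a₃) ^ 2 * (W.addX x x (W.slope x x y y) - e₁) =
      ((x - e₁) ^ 2 - (e₁ - e₂) * (e₁ - e₃)) ^ 2 := by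
  have h4 : (4 : F) ≠ 0 := four_ne_zero_of_two_ne_zero
  rw [h.equation_iff] at he
  have hη : y - W.negY x y = 2 * y + W.a₁ * x + W.a₃ := by
    rw [negY]
    ring
  have hslope := eq_div_iff (sub_ne_zero.mpr hy) |>.mp (slope_of_Y_ne (W := W) rfl hy)
  rw [hη] at hslope
  rw [addX]
  generalize W.slope x x y y = ℓ at hslope
  set η := 2 * y + W.a₁ * x + W.a₃ with hη'
  have hder : 2 * (ℓ * η) + W.a₁ * η =
      2 * ((x - e₁) * (x - e₂) + (x - e₁) * (x - e₃) + (x - e₂) * (x - e₃)) := by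
    rw [hslope, hη']
    linear_combination x * h.b₂_eq + h.b₄_eq
  apply mul_left_cancel₀ h4
  linear_combination (2 * (ℓ * η) + W.a₁ * η +
      2 * ((x - e₁) * (x - e₂) + (x - e₁) * (x - e₃) + (x - e₂) * (x - e₃))) * hder -
    η ^ 2 * h.b₂_eq + (4 * (e₁ + e₂ + e₃) - 8 * x - 4 * e₁) * he

lemma exists_sq_eq_addX_self_sub [NeZero (2 : F)] [DecidableEq F] (h : W.TwoTorsionSplits e₁ e₂ e₃)
    {x y : F} (he : W.Equation x y) (hy : y ≠ W.negY x y) :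
    ∃ z, W.addX x x (W.slope x x y y) - e₁ = z ^ 2 := by
  have hη : 2 * y + W.a₁ * x + W.a₃ ≠ 0 := fun h0 ↦ hy <| by
    rw [negY]
    linear_combination h0
  refine ⟨((x - e₁) ^ 2 - (e₁ - e₂) * (e₁ - e₃)) / (2 * y + W.a₁ * x + W.a₃), ?_⟩
  rw [div_pow, eq_div_iff (pow_ne_zero 2 hη), mul_comm]
  exact h.sq_mul_addX_self_sub he hy

lemma exists_addOrderOf_eq_four_of_sq [NeZero (2 : F)] [DecidableEq F]
    (h : W.TwoTorsionSplits e₁ e₂ e₃) (h12 : e₁ ≠ e₂) (h13 : e₁ ≠ e₃) (h23 : e₂ ≠ e₃)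
    (hΔ : W.Δ ≠ 0) {r s : F} (hr : e₁ - e₂ = r ^ 2) (hs : e₁ - e₃ = s ^ 2) :
    ∃ P : W.Point, addOrderOf P = 4 := by
  have h2 : (2 : F) ≠ 0 := two_ne_zero
  have hr0 : r ≠ 0 := by
    rintro rfl
    exact h12 (by linear_combination hr)
  have hs0 : s ≠ 0 := by
    rintro rfl
    exact h13 (by linear_combination hs)
  have hrs : r + s ≠ 0 := fun h0 ↦ h23 (by linear_combination hs - hr + (s - r) * h0)
  obtain ⟨x, hx⟩ : ∃ x, x = e₁ + r * s := ⟨_, rfl⟩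
  obtain ⟨y, hy⟩ : ∃ y, 2 * y + W.a₁ * x + W.a₃ = 2 * (r * s * (r + s)) :=
    ⟨r * s * (r + s) - (W.a₁ * x + W.a₃) / 2, by field_simp; ring⟩
  have hη : 2 * y + W.a₁ * x + W.a₃ ≠ 0 := by
    rw [hy]
    exact mul_ne_zero h2 (mul_ne_zero (mul_ne_zero hr0 hs0) hrs)
  have hy_ne : y ≠ W.negY x y := fun h0 ↦ hη <| by
    rw [negY] at h0
    linear_combination h0
  have he₂ : e₂ = e₁ - r ^ 2 := by linear_combination -hr
  have he₃ : e₃ = e₁ - s ^ 2 := by linear_combination -hs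
  have he : W.Equation x y := by
    rw [h.equation_iff, hy, hx, he₂, he₃]
    ring
  have hns := (W.equation_iff_nonsingular_of_Δ_ne_zero hΔ).mp he
  have hX : W.addX x x (W.slope x x y y) = e₁ := by
    have := h.sq_mul_addX_self_sub he hy_ne
    rw [hr, hs, hx, show (e₁ + r * s - e₁) ^ 2 - r ^ 2 * s ^ 2 = 0 by ring, ← hx,
      zero_pow two_ne_zero, mul_eq_zero, or_iff_right (pow_ne_zero 2 hη)] at this
    exact sub_eq_zero.mp this
  have hadd := Point.add_self_of_Y_ne (h₁ := hns) hy_ne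
  have : Fact (Nat.Prime 2) := ⟨Nat.prime_two⟩
  refine ⟨.some x y hns, addOrderOf_eq_prime_pow (p := 2) (n := 1) ?_ ?_⟩
  · rw [pow_one, two_nsmul, hadd]
    exact Point.some_ne_zero _
  · rw [show 2 ^ (1 + 1) = 2 * 2 by norm_num, mul_nsmul, two_nsmul, two_nsmul, hadd]
    apply Point.add_self_of_Y_eq
    have heq := (h.equation_iff _ _).mp
      (nonsingular_add hns hns fun hxy ↦ hy_ne hxy.right).left
    rw [hX, sub_self, zero_mul, zero_mul, mul_zero] at heq
    have heq := pow_eq_zero_iff two_ne_zero |>.mp heq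
    rw [hX, negY]
    linear_combination heq

lemma exists_sq_of_addOrderOf_eq_four [NeZero (2 : F)] [DecidableEq F]
    (h : W.TwoTorsionSplits e₁ e₂ e₃) {P : W.Point} (hP : addOrderOf P = 4) :
    ((∃ z, e₁ - e₂ = z ^ 2) ∧ ∃ z, e₁ - e₃ = z ^ 2) ∨
      ((∃ z, e₂ - e₃ = z ^ 2) ∧ ∃ z, e₂ - e₁ = z ^ 2) ∨
      ((∃ z, e₃ - e₁ = z ^ 2) ∧ ∃ z, e₃ - e₂ = z ^ 2) := by
  have hP2 : P + P ≠ 0 := fun h0 ↦ by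
    have := addOrderOf_dvd_of_nsmul_eq_zero (two_nsmul P ▸ h0)
    rw [hP] at this
    norm_num at this
  have hP4 : (P + P) + (P + P) = 0 := by
    rw [← two_nsmul, ← two_nsmul, ← mul_nsmul, ← addOrderOf_dvd_iff_nsmul_eq_zero, hP]
  rcases P with _ | ⟨x, y, hns⟩
  · exact absurd (add_zero _) hP2
  have hy_ne : y ≠ W.negY x y := fun h0 ↦ hP2 (Point.add_self_of_Y_eq h0)
  obtain ⟨X, Y, hns', hadd, s₁, s₂, s₃⟩ : ∃ X Y, ∃ hns' : W.Nonsingular X Y,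
      Point.some x y hns + Point.some x y hns = Point.some X Y hns' ∧
      (∃ z, X - e₁ = z ^ 2) ∧ (∃ z, X - e₂ = z ^ 2) ∧ ∃ z, X - e₃ = z ^ 2 :=
    ⟨_, _, _, Point.add_self_of_Y_ne hy_ne, h.exists_sq_eq_addX_self_sub hns.left hy_ne,
      h.rotate.exists_sq_eq_addX_self_sub hns.left hy_ne,
      h.rotate.rotate.exists_sq_eq_addX_self_sub hns.left hy_ne⟩
  have heq := (h.equation_iff _ _).mp hns'.left
  rw [hadd] at hP4
  have hY : Y = W.negY X Y := by
    by_contra hne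
    rw [Point.add_self_of_Y_ne hne] at hP4
    exact Point.some_ne_zero _ hP4
  have hη : 2 * Y + W.a₁ * X + W.a₃ = 0 := by
    rw [negY] at hY
    linear_combination hY
  have h4 : (4 : F) ≠ 0 := four_ne_zero_of_two_ne_zero
  rw [hη, zero_pow two_ne_zero, eq_comm, mul_eq_zero, or_iff_right h4, mul_eq_zero, mul_eq_zero,
    sub_eq_zero, sub_eq_zero, sub_eq_zero] at heq
  rcases heq with (rfl | rfl) | rfl
  · exact .inl ⟨s₂, s₃⟩
  · exact .inr (.inl ⟨s₃, s₁⟩)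
  · exact .inr (.inr ⟨s₁, s₂⟩)

lemma exists_addOrderOf_eq_four_iff [NeZero (2 : F)] [DecidableEq F]
    (h : W.TwoTorsionSplits e₁ e₂ e₃) (h12 : e₁ ≠ e₂) (h13 : e₁ ≠ e₃) (h23 : e₂ ≠ e₃)
    (hΔ : W.Δ ≠ 0) :
    (∃ P : W.Point, addOrderOf P = 4) ↔
      ((∃ z, e₁ - e₂ = z ^ 2) ∧ ∃ z, e₁ - e₃ = z ^ 2) ∨
      ((∃ z, e₂ - e₃ = z ^ 2) ∧ ∃ z, e₂ - e₁ = z ^ 2) ∨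
      ((∃ z, e₃ - e₁ = z ^ 2) ∧ ∃ z, e₃ - e₂ = z ^ 2) := by
  refine ⟨fun ⟨P, hP⟩ ↦ h.exists_sq_of_addOrderOf_eq_four hP, ?_⟩
  rintro (⟨⟨r, hr⟩, s, hs⟩ | ⟨⟨r, hr⟩, s, hs⟩ | ⟨⟨r, hr⟩, s, hs⟩)
  · exact h.exists_addOrderOf_eq_four_of_sq h12 h13 h23 hΔ hr hs
  · exact h.rotate.exists_addOrderOf_eq_four_of_sq h23 h12.symm h13.symm hΔ hr hs
  · exact h.rotate.rotate.exists_addOrderOf_eq_four_of_sq h13.symm h23.symm h12 hΔ hr hs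

end TwoTorsionSplits

end WeierstrassCurve.Affine

/-- `E(ℚ)` contains a point of order 4 if and only if one of:
(i) `(k₁−k₃)(k₂−k₄)` and `(k₁−k₂)(k₃−k₄)` are both squares in `ℚ`; or
(ii) `(k₂−k₃)(k₁−k₄)` and `(k₁−k₂)(k₄−k₃)` are both squares in `ℚ`; or
(iii) `(k₃−k₂)(k₁−k₄)` and `(k₁−k₃)(k₄−k₂)` are both squares in `ℚ`. -/
theorem quartic_four_torsion_criterion
    (k₁ k₂ k₃ k₄ : ℚ)
    (hk₁ : k₁ ≠ 0) (hk₂ : k₂ ≠ 0) (hk₃ : k₃ ≠ 0) (hk₄ : k₄ ≠ 0)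
    (h12 : k₁ ≠ k₂) (h13 : k₁ ≠ k₃) (h14 : k₁ ≠ k₄)
    (h23 : k₂ ≠ k₃) (h24 : k₂ ≠ k₄) (h34 : k₃ ≠ k₄)
    (W : WeierstrassCurve.Affine ℚ)
    (hW : W = { a₁ := k₁ + k₂ + k₃ + k₄,
                a₂ := (k₁ * k₂ + k₁ * k₃ + k₁ * k₄ + k₂ * k₃ + k₂ * k₄ + k₃ * k₄) -
                  (k₁ + k₂ + k₃ + k₄) ^ 2 / 4,
                a₃ := 2 * (k₁ * k₂ * k₃ + k₁ * k₂ * k₄ + k₁ * k₃ * k₄ + k₂ * k₃ * k₄),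
                a₄ := -4 * (k₁ * k₂ * k₃ * k₄),
                a₆ := ((k₁ * k₂ + k₁ * k₃ + k₁ * k₄ + k₂ * k₃ + k₂ * k₄ + k₃ * k₄) -
                  (k₁ + k₂ + k₃ + k₄) ^ 2 / 4) * (-4 * (k₁ * k₂ * k₃ * k₄)) })
    (hΔ : W.Δ ≠ 0) :
    (∃ P : W.Point, addOrderOf P = 4) ↔
      ((∃ z : ℚ, (k₁ - k₃) * (k₂ - k₄) = z ^ 2) ∧ (∃ z : ℚ, (k₁ - k₂) * (k₃ - k₄) = z ^ 2)) ∨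
      ((∃ z : ℚ, (k₂ - k₃) * (k₁ - k₄) = z ^ 2) ∧ (∃ z : ℚ, (k₁ - k₂) * (k₄ - k₃) = z ^ 2)) ∨
      ((∃ z : ℚ, (k₃ - k₂) * (k₁ - k₄) = z ^ 2) ∧ (∃ z : ℚ, (k₁ - k₃) * (k₄ - k₂) = z ^ 2)) := by
  have hs : W.TwoTorsionSplits (-(k₁ * k₄ + k₂ * k₃)) (-(k₁ * k₃ + k₂ * k₄))
      (-(k₁ * k₂ + k₃ * k₄)) := by
    subst hW
    constructor <;> ring
  have h12' : (k₁ - k₂) * (k₃ - k₄) ≠ 0 := mul_ne_zero (sub_ne_zero.mpr h12) (sub_ne_zero.mpr h34)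
  have h13' : (k₁ - k₃) * (k₂ - k₄) ≠ 0 := mul_ne_zero (sub_ne_zero.mpr h13) (sub_ne_zero.mpr h24)
  have h23' : (k₂ - k₃) * (k₁ - k₄) ≠ 0 := mul_ne_zero (sub_ne_zero.mpr h23) (sub_ne_zero.mpr h14)
  have e12 : -(k₁ * k₄ + k₂ * k₃) - -(k₁ * k₃ + k₂ * k₄) = (k₁ - k₂) * (k₃ - k₄) := by ring
  have e13 : -(k₁ * k₄ + k₂ * k₃) - -(k₁ * k₂ + k₃ * k₄) = (k₁ - k₃) * (k₂ - k₄) := by ring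
  have e23 : -(k₁ * k₃ + k₂ * k₄) - -(k₁ * k₂ + k₃ * k₄) = (k₂ - k₃) * (k₁ - k₄) := by ring
  have e21 : -(k₁ * k₃ + k₂ * k₄) - -(k₁ * k₄ + k₂ * k₃) = (k₁ - k₂) * (k₄ - k₃) := by ring
  have e31 : -(k₁ * k₂ + k₃ * k₄) - -(k₁ * k₄ + k₂ * k₃) = (k₁ - k₃) * (k₄ - k₂) := by ring
  have e32 : -(k₁ * k₂ + k₃ * k₄) - -(k₁ * k₃ + k₂ * k₄) = (k₃ - k₂) * (k₁ - k₄) := by ring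
  rw [hs.exists_addOrderOf_eq_four_iff (sub_ne_zero.mp (e12 ▸ h12')) (sub_ne_zero.mp (e13 ▸ h13'))
    (sub_ne_zero.mp (e23 ▸ h23')) hΔ, e12, e13, e23, e21, e31, e32]
  tauto
end

section
/- Let t, r ∈ ℚ with r ≠ 0 and r² = 1369 + 32t(232 + t(419 + 252t)). Set a₅ = −4(1+2t)(7+13t)(13+22t)/r². Then for every pair of distinct entries x, y of the list t, 16t+8, 25t+14, 36t+20, a₅, the rational number x·y + (16t+9) is a square in ℚ. In particular, whenever these five rational numbers are nonzero and pairwise distinct, the set {t, 16t+8, 25t+14, 36t+20, a₅} is a rational D(16t+9)-quintuple. -/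
/-- A rational `D(q)`-quintuple: five distinct nonzero rationals such that the product of any two
distinct elements plus `q` is a rational square. -/
def IsRationalDQuintuple (q : ℚ) (S : Finset ℚ) : Prop :=
  S.card = 5 ∧ (∀ x ∈ S, x ≠ 0) ∧ ∀ x ∈ S, ∀ y ∈ S, x ≠ y → ∃ z : ℚ, x * y + q = z ^ 2

/-- if `r ≠ 0` and `r² = 1369 + 32t(232 + t(419 + 252t))`, then with
`a₅ = −4(1+2t)(7+13t)(13+22t)/r²`, any two distinct entries of the list
`t, 16t+8, 25t+14, 36t+20, a₅` have product plus `16t+9` a rational square; in particular, when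
these five rationals are nonzero and pairwise distinct they form a rational `D(16t+9)`-quintuple. -/
theorem extend_D_16t_add_9_quadruple
    (t r : ℚ) (hr : r ≠ 0)
    (hr2 : r ^ 2 = 1369 + 32 * t * (232 + t * (419 + 252 * t)))
    (a₅ : ℚ) (ha₅ : a₅ = -4 * (1 + 2 * t) * (7 + 13 * t) * (13 + 22 * t) / r ^ 2) :
    (∀ i j : Fin 5, i ≠ j →
      ∃ z : ℚ, ![t, 16 * t + 8, 25 * t + 14, 36 * t + 20, a₅] i *
        ![t, 16 * t + 8, 25 * t + 14, 36 * t + 20, a₅] j + (16 * t + 9) = z ^ 2) ∧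
    ((Function.Injective ![t, 16 * t + 8, 25 * t + 14, 36 * t + 20, a₅] ∧
        ∀ i : Fin 5, ![t, 16 * t + 8, 25 * t + 14, 36 * t + 20, a₅] i ≠ 0) →
      IsRationalDQuintuple (16 * t + 9)
        {t, 16 * t + 8, 25 * t + 14, 36 * t + 20, a₅}) := by
  have fifth : ∀ x z : ℚ,
      x * (-4 * (1 + 2 * t) * (7 + 13 * t) * (13 + 22 * t)) +
        (16 * t + 9) * (1369 + 32 * t * (232 + t * (419 + 252 * t))) = z ^ 2 →
      x * a₅ + (16 * t + 9) = (z / r) ^ 2 := by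
    intro x z h
    rw [← hr2] at h
    rw [ha₅, div_pow, ← h]
    field_simp
  have ordered : ∀ i j : Fin 5, i < j →
      ∃ z : ℚ, ![t, 16 * t + 8, 25 * t + 14, 36 * t + 20, a₅] i *
        ![t, 16 * t + 8, 25 * t + 14, 36 * t + 20, a₅] j + (16 * t + 9) = z ^ 2 := by
    intro i j hij
    fin_cases i <;> fin_cases j <;> first | exact absurd hij (by decide) | skip
    · exact ⟨4 * t + 3, by simp; ring⟩
    · exact ⟨5 * t + 3, by simp; ring⟩
    · exact ⟨6 * t + 3, by simp; ring⟩
    · exact ⟨_, fifth t (356 * t ^ 2 + 398 * t + 111) (by ring)⟩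
    · exact ⟨20 * t + 11, by simp; ring⟩
    · exact ⟨24 * t + 13, by simp; ring⟩
    · exact ⟨_, fifth (16 * t + 8) (304 * t ^ 2 + 344 * t + 97) (by ring)⟩
    · exact ⟨30 * t + 17, by simp; ring⟩
    · exact ⟨_, fifth (25 * t + 14) (268 * t ^ 2 + 302 * t + 85) (by ring)⟩
    · exact ⟨_, fifth (36 * t + 20) (216 * t ^ 2 + 248 * t + 71) (by ring)⟩
  have pairs : ∀ i j : Fin 5, i ≠ j →
      ∃ z : ℚ, ![t, 16 * t + 8, 25 * t + 14, 36 * t + 20, a₅] i *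
        ![t, 16 * t + 8, 25 * t + 14, 36 * t + 20, a₅] j + (16 * t + 9) = z ^ 2 := by
    intro i j hij
    rcases lt_or_gt_of_ne hij with h | h
    · exact ordered i j h
    · obtain ⟨z, hz⟩ := ordered j i h
      exact ⟨z, by rw [mul_comm, hz]⟩
  refine ⟨pairs, ?_⟩
  rintro ⟨hinj, hne⟩
  have himage : ({t, 16 * t + 8, 25 * t + 14, 36 * t + 20, a₅} : Finset ℚ) =
      Finset.univ.image ![t, 16 * t + 8, 25 * t + 14, 36 * t + 20, a₅] := by
    ext x
    simp [Fin.exists_fin_succ, eq_comm]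
  rw [himage]
  refine ⟨by rw [Finset.card_image_of_injective _ hinj]; simp, ?_, ?_⟩
  · intro x hx
    obtain ⟨i, -, rfl⟩ := Finset.mem_image.1 hx
    exact hne i
  · intro x hx y hy hxy
    obtain ⟨i, -, rfl⟩ := Finset.mem_image.1 hx
    obtain ⟨j, -, rfl⟩ := Finset.mem_image.1 hy
    exact pairs i j fun h => hxy (h ▸ rfl)
end

section
/- There exist infinitely many t ∈ ℚ such that the set {t, 16t+8, 25t+14, 36t+20, −4(1+2t)(7+13t)(13+22t)/(1369 + 32t(232 + t(419 + 252t)))} is a rational D(16t+9)-quintuple. -/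
open Polynomial in
/-- Outside a finite set of parameters, the quintuple condition reduces to the denominator of the
fifth element being a square. -/
theorem exists_finite_forall_isRationalDQuintuple :
    ∃ B : Set ℚ, B.Finite ∧ ∀ t ∉ B, ∀ w : ℚ,
      1369 + 32 * t * (232 + t * (419 + 252 * t)) = w ^ 2 →
      IsRationalDQuintuple (16 * t + 9)
        {t, 16 * t + 8, 25 * t + 14, 36 * t + 20,
          -4 * (1 + 2 * t) * (7 + 13 * t) * (13 + 22 * t) /
            (1369 + 32 * t * (232 + t * (419 + 252 * t)))} := by
  let D : ℚ[X] := 1369 + 32 * X * (232 + X * (419 + 252 * X))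
  let N : ℚ[X] := -4 * (1 + 2 * X) * (7 + 13 * X) * (13 + 22 * X)
  let P : ℚ[X] := X * (16 * X + 8) * (25 * X + 14) * (36 * X + 20) * D * N *
    (X - (16 * X + 8)) * (X - (25 * X + 14)) * (X - (36 * X + 20)) *
    (16 * X + 8 - (25 * X + 14)) * (16 * X + 8 - (36 * X + 20)) *
    (25 * X + 14 - (36 * X + 20)) *
    (X * D - N) * ((16 * X + 8) * D - N) * ((25 * X + 14) * D - N) * ((36 * X + 20) * D - N)
  have hP : P ≠ 0 := by
    intro h
    have h1 : P.eval 1 = 0 := by rw [h, eval_zero]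
    norm_num [P, D, N] at h1
  refine ⟨{t | P.IsRoot t}, finite_setOfPred_isRoot hP, fun t ht w hw => ?_⟩
  simp only [Set.mem_ofPred_eq, IsRoot.def, P, D, N, eval_mul, eval_add, eval_sub, eval_neg, eval_X,
    eval_one, eval_ofNat, mul_eq_zero, not_or] at ht
  obtain ⟨⟨⟨⟨⟨⟨⟨⟨⟨⟨⟨⟨⟨⟨⟨ha, hb⟩, hc⟩, hd⟩, hD⟩, hN⟩, hab⟩, hac⟩, had⟩, hbc⟩, hbd⟩, hcd⟩,
    hae⟩, hbe⟩, hce⟩, hde⟩ := ht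
  have hN' : -4 * (1 + 2 * t) * (7 + 13 * t) * (13 + 22 * t) ≠ 0 := by
    simpa only [ne_eq, mul_eq_zero, not_or] using hN
  have hw0 : w ≠ 0 := by
    rintro rfl
    exact hD (by rw [hw]; norm_num)
  set e := -4 * (1 + 2 * t) * (7 + 13 * t) * (13 + 22 * t) /
    (1369 + 32 * t * (232 + t * (419 + 252 * t))) with he
  have he0 : e ≠ 0 := div_ne_zero hN' hD
  have hne {x : ℚ} (h : ¬ x * (1369 + 32 * t * (232 + t * (419 + 252 * t))) -
      -4 * (1 + 2 * t) * (7 + 13 * t) * (13 + 22 * t) = 0) : x ≠ e := by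
    intro hx
    rw [he, eq_div_iff hD] at hx
    exact h (sub_eq_zero.2 hx)
  have hsq {x r : ℚ} (h : x * (-4 * (1 + 2 * t) * (7 + 13 * t) * (13 + 22 * t)) +
      (16 * t + 9) * (1369 + 32 * t * (232 + t * (419 + 252 * t))) = r ^ 2) :
      ∃ z : ℚ, x * e + (16 * t + 9) = z ^ 2 := by
    refine ⟨r / w, ?_⟩
    rw [div_pow, ← h, ← hw, he, add_div, mul_div_assoc x, mul_div_cancel_right₀ _ hD]
  have hAE := hsq (x := t) (r := 356 * t ^ 2 + 398 * t + 111) (by ring)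
  have hBE := hsq (x := 16 * t + 8) (r := 304 * t ^ 2 + 344 * t + 97) (by ring)
  have hCE := hsq (x := 25 * t + 14) (r := 268 * t ^ 2 + 302 * t + 85) (by ring)
  have hDE := hsq (x := 36 * t + 20) (r := 216 * t ^ 2 + 248 * t + 71) (by ring)
  have hAB : ∃ z : ℚ, t * (16 * t + 8) + (16 * t + 9) = z ^ 2 := ⟨4 * t + 3, by ring⟩
  have hAC : ∃ z : ℚ, t * (25 * t + 14) + (16 * t + 9) = z ^ 2 := ⟨5 * t + 3, by ring⟩
  have hAD : ∃ z : ℚ, t * (36 * t + 20) + (16 * t + 9) = z ^ 2 := ⟨6 * t + 3, by ring⟩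
  have hBC : ∃ z : ℚ, (16 * t + 8) * (25 * t + 14) + (16 * t + 9) = z ^ 2 :=
    ⟨20 * t + 11, by ring⟩
  have hBD : ∃ z : ℚ, (16 * t + 8) * (36 * t + 20) + (16 * t + 9) = z ^ 2 :=
    ⟨24 * t + 13, by ring⟩
  have hCD : ∃ z : ℚ, (25 * t + 14) * (36 * t + 20) + (16 * t + 9) = z ^ 2 :=
    ⟨30 * t + 17, by ring⟩
  replace hae := hne hae
  replace hbe := hne hbe
  replace hce := hne hce
  replace hde := hne hde
  rw [sub_eq_zero] at hab hac had hbc hbd hcd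
  clear_value e
  clear he hne hsq
  generalize 16 * t + 9 = q at *
  generalize 16 * t + 8 = b at *
  generalize 25 * t + 14 = c at *
  generalize 36 * t + 20 = d at *
  refine ⟨?_, ?_, ?_⟩
  · rw [Finset.card_insert_of_notMem, Finset.card_insert_of_notMem, Finset.card_insert_of_notMem,
      Finset.card_insert_of_notMem, Finset.card_singleton] <;> simp [*]
  · simp [*]
  · intro x hx y hy hxy
    simp only [Finset.mem_insert, Finset.mem_singleton] at hx hy
    rcases hx with rfl | rfl | rfl | rfl | rfl <;> rcases hy with rfl | rfl | rfl | rfl | rfl <;>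
      first
        | exact absurd rfl hxy
        | assumption
        | (rw [mul_comm]; assumption)

/-- The tangent construction on the curve `y ^ 2 = A x ^ 3 + B x ^ 2 + C x + E`. -/
theorem cubic_tangent_point {K : Type*} [Field K] {A B C E x y x' l : K}
    (h : A * x ^ 3 + B * x ^ 2 + C * x + E = y ^ 2)
    (hl : 2 * y * l = 3 * A * x ^ 2 + 2 * B * x + C) (hx' : A * x' = l ^ 2 - B - 2 * A * x) :
    A * x' ^ 3 + B * x' ^ 2 + C * x' + E = (y + l * (x' - x)) ^ 2 := by
  linear_combination h - (x' - x) * hl + (x' - x) ^ 2 * hx'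

/-- The curve `63 x ^ 3 + 3352 x ^ 2 + 59392 x + 350464 = y ^ 2` has rational points whose
abscissa has a denominator divisible by an arbitrarily large power of `2`. -/
theorem exists_point_four_pow_dvd (k : ℕ) :
    ∃ a d : ℤ, Odd a ∧ d ≠ 0 ∧ 4 ^ k ∣ d ∧ ∃ w : ℚ,
      63 * (a / d : ℚ) ^ 3 + 3352 * (a / d : ℚ) ^ 2 + 59392 * (a / d : ℚ) + 350464 = w ^ 2 := by
  induction k with
  | zero => exact ⟨-17, 1, by decide, one_ne_zero, one_dvd _, 3, by norm_num⟩
  | succ k ih =>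
    obtain ⟨a, d, ha, hd, hk, w, hw⟩ := ih
    obtain ⟨F, hF⟩ : ∃ F : ℤ,
      F = 63 * a ^ 3 + 3352 * a ^ 2 * d + 59392 * a * d ^ 2 + 350464 * d ^ 3 := ⟨_, rfl⟩
    obtain ⟨G, hG⟩ : ∃ G : ℤ, G = 189 * a ^ 2 + 6704 * a * d + 59392 * d ^ 2 := ⟨_, rfl⟩
    have hFodd : Odd F := by
      rw [hF]; simp [parity_simps, ha, show Odd (63 : ℤ) by decide,
        show Even (3352 : ℤ) by decide, show Even (59392 : ℤ) by decide,
        show Even (350464 : ℤ) by decide]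
    have hGodd : Odd G := by
      rw [hG]; simp [parity_simps, ha, show Odd (189 : ℤ) by decide,
        show Even (6704 : ℤ) by decide, show Even (59392 : ℤ) by decide]
    have hF0 : F ≠ 0 := by
      rintro rfl
      exact absurd hFodd (by decide)
    have hdQ : (d : ℚ) ≠ 0 := by exact_mod_cast hd
    have hFQ : (F : ℚ) ≠ 0 := by exact_mod_cast hF0
    have hFw : (F : ℚ) = w ^ 2 * d ^ 3 := by
      rw [hF, ← hw]; push_cast; field_simp
    have hGd : 3 * 63 * (a / d : ℚ) ^ 2 + 2 * 3352 * (a / d : ℚ) + 59392 = G / d ^ 2 := by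
      rw [hG]; push_cast; field_simp; ring
    have hw0 : w ≠ 0 := by
      rintro rfl
      exact hFQ (by rw [hFw]; ring)
    refine ⟨G ^ 2 - 4 * F * (3352 * d + 126 * a), 252 * d * F, ?_, ?_, ?_, _,
      cubic_tangent_point hw (l := G / d ^ 2 / (2 * w)) ?_ ?_⟩
    · exact hGodd.pow.sub_even (by
        rw [mul_assoc]; exact Even.mul_right (by decide) _)
    · simp [hd, hF0]
    · rw [pow_succ, show 252 * d * F = d * 4 * (63 * F) by ring]
      exact (mul_dvd_mul_right hk 4).mul_right _
    · rw [hGd]; field_simp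
    · push_cast
      rw [hFw]
      field_simp
      ring

/-- The curve `w ^ 2 = 1369 + 32 t (232 + t (419 + 252 t))` has infinitely many rational points. -/
theorem infinite_setOf_denominator_eq_sq :
    {t : ℚ | ∃ w : ℚ, 1369 + 32 * t * (232 + t * (419 + 252 * t)) = w ^ 2}.Infinite := by
  intro hfin
  obtain ⟨M, hM⟩ := (hfin.image Rat.den).bddAbove
  obtain ⟨a, d, ha, hd, hk, w, hw⟩ := exists_point_four_pow_dvd M
  have hdQ : (d : ℚ) ≠ 0 := by exact_mod_cast hd
  obtain ⟨t, ht⟩ : ∃ t : ℚ, t = a / d / 32 := ⟨_, rfl⟩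
  have hmem : t.den ≤ M := by
    refine hM ⟨t, ⟨w / 16, ?_⟩, rfl⟩
    rw [div_pow, ← hw, ht]
    ring
  have hden : 4 ^ M ∣ t.den := by
    have hcross : t.num * (d * 32) = a * t.den := by
      have h : (t.num : ℚ) / t.den = a / d / 32 := by rw [Rat.num_div_den, ht]
      have htd : (t.den : ℚ) ≠ 0 := by exact_mod_cast t.den_nz
      field_simp at h
      exact_mod_cast (by linear_combination h : (t.num : ℚ) * (d * 32) = a * t.den)
    have hcop : IsCoprime ((4 : ℤ) ^ M) a := by
      apply IsCoprime.pow_left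
      have h2 : IsCoprime (2 : ℤ) a := Int.isCoprime_two_left.2 ha
      exact (h2.mul_left h2 : IsCoprime (2 * 2 : ℤ) a)
    have hdvd : (4 : ℤ) ^ M ∣ a * t.den :=
      hcross ▸ (hk.mul_right 32).mul_left t.num
    exact_mod_cast hcop.dvd_of_dvd_mul_left hdvd
  exact absurd (Nat.le_of_dvd t.den_pos hden) 
    (not_le.2 (hmem.trans_lt (Nat.lt_pow_self (by norm_num))))

/-- there are infinitely many `t ∈ ℚ` such that
`{t, 16t+8, 25t+14, 36t+20, −4(1+2t)(7+13t)(13+22t)/(1369 + 32t(232 + t(419 + 252t)))}`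
is a rational `D(16t+9)`-quintuple. -/
theorem infinitely_many_D_16t_add_9_quintuples :
    {t : ℚ | IsRationalDQuintuple (16 * t + 9)
      {t, 16 * t + 8, 25 * t + 14, 36 * t + 20,
        -4 * (1 + 2 * t) * (7 + 13 * t) * (13 + 22 * t) /
          (1369 + 32 * t * (232 + t * (419 + 252 * t)))}}.Infinite := by
  obtain ⟨B, hB, h⟩ := exists_finite_forall_isRationalDQuintuple
  refine (infinite_setOf_denominator_eq_sq.sdiff hB).mono ?_
  rintro t ⟨⟨w, hw⟩, ht⟩
  exact h t ht w hw
end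

section
/- There exist infinitely many t ∈ ℚ such that the set {4t, 144t+8, 25t+1, 49t+3, −4(2+37t)(3+58t)(5+82t)/(−1 + 32t(13 + t(529 + 5148t)))} is a rational D(16t+1)-quintuple. -/
/-- The doubling formula: if `x` is the abscissa of a rational point with nonzero ordinate on
`y ^ 2 = x ^ 3 + b * x ^ 2 + c * x + d`, then so is `m ^ 2 - b - 2 * x`, where `m` is the slope of
the tangent line. -/
lemma isSquare_cubic_double {b c d x y m : ℚ} (hy : y ^ 2 = x ^ 3 + b * x ^ 2 + c * x + d)
    (hm : 2 * y * m = 3 * x ^ 2 + 2 * b * x + c) {x' : ℚ} (hx' : x' = m ^ 2 - b - 2 * x) :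
    (y + m * (x' - x)) ^ 2 = x' ^ 3 + b * x' ^ 2 + c * x' + d := by
  have hb : b = m ^ 2 - 2 * x - x' := by linear_combination hx'
  subst hb
  linear_combination hy + (x' - x) * hm

/-- Doubling a point with abscissa of `2`-adic valuation `-2 * k < 0` lowers this valuation
by `2`. -/
lemma exists_point_succ_valuation {b c d : ℤ} {k : ℕ} (hk : k ≠ 0)
    (h : ∃ n m : ℤ, Odd n ∧ Odd m ∧ ∃ x y : ℚ, x * (4 ^ k * m) = n ∧
      y ^ 2 = x ^ 3 + b * x ^ 2 + c * x + d) :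
    ∃ n m : ℤ, Odd n ∧ Odd m ∧ ∃ x y : ℚ, x * (4 ^ (k + 1) * m) = n ∧
      y ^ 2 = x ^ 3 + b * x ^ 2 + c * x + d := by
  obtain ⟨n, m, hn, hm, x, y, hx, hy⟩ := h
  obtain ⟨D, hD⟩ : ∃ D : ℤ, D = 4 ^ k * m := ⟨_, rfl⟩
  have hDe : Even D := by
    rw [hD]
    exact ((by decide : Even (4 : ℤ)).pow_of_ne_zero hk).mul_right m
  have hDx : x * D = n := by rw [hD]; push_cast; exact hx
  have hF : Odd (n ^ 4 + D * (-2 * c * n ^ 2 * D - 8 * d * n * D ^ 2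
      + (c ^ 2 - 4 * b * d) * D ^ 3)) := hn.pow.add_even (hDe.mul_right _)
  have hG : Odd (n ^ 3 + D * (b * n ^ 2 + c * n * D + d * D ^ 2)) :=
    hn.pow.add_even (hDe.mul_right _)
  have hm0 : (m : ℚ) ≠ 0 := by
    intro h0
    have : m = 0 := by exact_mod_cast h0
    simp [this] at hm
  have hD0 : (D : ℚ) ≠ 0 := by rw [hD]; push_cast; positivity
  have hGy : ((n ^ 3 + D * (b * n ^ 2 + c * n * D + d * D ^ 2) : ℤ) : ℚ) = D ^ 3 * y ^ 2 := by
    push_cast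
    rw [hy, ← hDx]
    ring
  have hy0 : y ≠ 0 := by
    rintro rfl
    have h0 : n ^ 3 + D * (b * n ^ 2 + c * n * D + d * D ^ 2) = 0 := by
      have : ((n ^ 3 + D * (b * n ^ 2 + c * n * D + d * D ^ 2) : ℤ) : ℚ) = 0 := by
        rw [hGy]; ring
      exact_mod_cast this
    rw [h0] at hG
    simp at hG
  obtain ⟨s, hs⟩ : ∃ s : ℚ, 2 * y * s = 3 * x ^ 2 + 2 * b * x + c :=
    ⟨(3 * x ^ 2 + 2 * b * x + c) / (2 * y), by field_simp⟩
  refine ⟨_, m * (n ^ 3 + D * (b * n ^ 2 + c * n * D + d * D ^ 2)), hF, hm.mul hG,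
    s ^ 2 - b - 2 * x, _, ?_, isSquare_cubic_double hy hs rfl⟩
  have h4 : (4 : ℚ) ^ (k + 1) * m = 4 * D := by rw [hD]; push_cast; ring
  rw [Int.cast_mul, ← mul_assoc ((4 : ℚ) ^ (k + 1)), h4, hGy]
  push_cast
  rw [← hDx]
  linear_combination (D : ℚ) ^ 4 * (2 * y * s + 3 * x ^ 2 + 2 * b * x + c) * hs
    - 4 * (D : ℚ) ^ 4 * (b + 2 * x) * hy

/-- An odd integer divided by `4 ^ k` times an odd integer determines `k`. -/
lemma pow_four_exponent_unique {x : ℚ} {k l : ℕ} {n m n' m' : ℤ} (hn : Odd n) (hm : Odd m)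
    (hn' : Odd n') (hm' : Odd m') (hx : x * (4 ^ k * m) = n) (hx' : x * (4 ^ l * m') = n') :
    k = l := by
  have key : ∀ {k l : ℕ} {n m n' m' : ℤ}, Odd m → Odd n' → x * (4 ^ k * m) = n →
      x * (4 ^ l * m') = n' → l ≤ k := by
    intro k l n m n' m' hm hn' hx hx'
    by_contra! hkl
    obtain ⟨j, rfl⟩ := Nat.exists_eq_add_of_lt hkl
    have h : n' * m = 4 ^ (j + 1) * (n * m') := by
      have : (n' * m : ℚ) = 4 ^ (j + 1) * (n * m') := by
        rw [← hx, ← hx']; ring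
      exact_mod_cast this
    have h1 := hn'.mul hm
    rw [h, Int.odd_mul] at h1
    exact absurd h1.1 (Int.not_odd_iff_even.2 ((by decide : Even (4 : ℤ)).pow_of_ne_zero
      j.succ_ne_zero))
  exact le_antisymm (key hm' hn hx' hx) (key hm hn' hx hx')

/-- A cubic with integer coefficients takes square values at infinitely many rationals as soon as
one of the points of `y ^ 2 = x ^ 3 + b * x ^ 2 + c * x + d` is not `2`-integral. -/
lemma infinite_isSquare_cubic {b c d : ℤ}
    (h : ∃ n m : ℤ, Odd n ∧ Odd m ∧ ∃ x y : ℚ, x * (4 ^ 1 * m) = n ∧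
      y ^ 2 = x ^ 3 + b * x ^ 2 + c * x + d) :
    {x : ℚ | ∃ y : ℚ, y ^ 2 = x ^ 3 + b * x ^ 2 + c * x + d}.Infinite := by
  have hall : ∀ k : ℕ, ∃ n m : ℤ, Odd n ∧ Odd m ∧ ∃ x y : ℚ, x * (4 ^ (k + 1) * m) = n ∧
      y ^ 2 = x ^ 3 + b * x ^ 2 + c * x + d := by
    intro k
    induction k with
    | zero => exact h
    | succ k ih => exact exists_point_succ_valuation k.succ_ne_zero ih
  choose n m hn hm x y hx hy using hall
  refine Set.infinite_of_injective_forall_mem (f := x) (fun k l hkl => ?_) fun k => ⟨y k, hy k⟩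
  have := pow_four_exponent_unique (hn k) (hm k) (hn l) (hm l) (hx k) (hkl ▸ hx l)
  omega

/-- The opposite of the denominator of the fifth element is a square infinitely often: the
substitution `t = -x / 10296` makes the cubic monic, and the point whose doublings are used is the
eighth multiple of `(0, 2574)`. -/
lemma infinite_isSquare_quintuple_cubic :
    {t : ℚ | ∃ y : ℚ, y ^ 2 = -(-1 + 32 * t * (13 + t * (529 + 5148 * t)))}.Infinite := by
  have h := infinite_isSquare_cubic (b := -1058) (c := 267696) (d := 6625476)
    ⟨86412040158760657595700273, 34081698206480409311281, by decide, by decide,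
      86412040158760657595700273 / (4 * 34081698206480409311281),
      -122231359203383813686403623350091950141 / 50335203257689784396825915661904568,
      by norm_num, by norm_num⟩
  refine Set.infinite_of_injOn_mapsTo (f := fun x : ℚ => -x / 10296)
    (fun x _ x' _ hx => ?_) ?_ h
  · simp only at hx
    linarith
  · rintro x ⟨y, hy⟩
    refine ⟨y / 2574, ?_⟩
    push_cast at hy
    rw [div_pow, hy]
    ring

/-- If `-D` is a square and `a * N + q * D` is the opposite of a square, then
`a * (N / D) + q` is a square. -/
lemma isSquare_mul_div_add {a q N D r y : ℚ} (hD : D ≠ 0) (hy : y ^ 2 = -D)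
    (h : a * N + q * D = -r ^ 2) : a * (N / D) + q = (r / y) ^ 2 := by
  rw [div_pow, hy]
  field_simp
  linear_combination h

lemma finite_setOf_quartic_eq_zero {a b c d e : ℚ} (h : a ≠ 0) :
    {t : ℚ | a * t ^ 4 + b * t ^ 3 + c * t ^ 2 + d * t + e = 0}.Finite := by
  open Polynomial in
  let p : ℚ[X] := C a * X ^ 4 + C b * X ^ 3 + C c * X ^ 2 + C d * X + C e
  have hp : p ≠ 0 := by
    intro h0
    apply h
    have := congrArg (fun r : Polynomial ℚ => r.coeff 4) h0
    simpa [p, Polynomial.coeff_X, Polynomial.coeff_C] using this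
  refine (Polynomial.finite_setOfPred_isRoot hp).subset fun t ht => ?_
  simpa [p, Polynomial.IsRoot] using ht

lemma isRationalDQuintuple_of_pairwise {q a b c d e : ℚ} (ha : a ≠ 0) (hb : b ≠ 0) (hc : c ≠ 0)
    (hd : d ≠ 0) (he : e ≠ 0) (nab : a ≠ b) (nac : a ≠ c) (nad : a ≠ d) (nae : a ≠ e)
    (nbc : b ≠ c) (nbd : b ≠ d) (nbe : b ≠ e) (ncd : c ≠ d) (nce : c ≠ e) (nde : d ≠ e)
    (hab : ∃ z, a * b + q = z ^ 2) (hac : ∃ z, a * c + q = z ^ 2) (had : ∃ z, a * d + q = z ^ 2)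
    (hae : ∃ z, a * e + q = z ^ 2) (hbc : ∃ z, b * c + q = z ^ 2) (hbd : ∃ z, b * d + q = z ^ 2)
    (hbe : ∃ z, b * e + q = z ^ 2) (hcd : ∃ z, c * d + q = z ^ 2) (hce : ∃ z, c * e + q = z ^ 2)
    (hde : ∃ z, d * e + q = z ^ 2) : IsRationalDQuintuple q {a, b, c, d, e} := by
  refine ⟨?_, ?_, ?_⟩
  · simp [nab, nac, nad, nae, nbc, nbd, nbe, ncd, nce, nde]
  · simp [ha, hb, hc, hd, he]
  · intro x hx y hy hxy
    simp only [Finset.mem_insert, Finset.mem_singleton] at hx hy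
    rcases hx with rfl | rfl | rfl | rfl | rfl <;> rcases hy with rfl | rfl | rfl | rfl | rfl <;>
      first
      | exact absurd rfl hxy
      | assumption
      | (rw [mul_comm]; assumption)

/-- there are infinitely many `t ∈ ℚ` such that
`{4t, 144t+8, 25t+1, 49t+3, −4(2+37t)(3+58t)(5+82t)/(−1 + 32t(13 + t(529 + 5148t)))}`
is a rational `D(16t+1)`-quintuple. -/
theorem infinitely_many_D_16t_add_1_quintuples :
    {t : ℚ | IsRationalDQuintuple (16 * t + 1)
      {4 * t, 144 * t + 8, 25 * t + 1, 49 * t + 3,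
        -4 * (2 + 37 * t) * (3 + 58 * t) * (5 + 82 * t) /
          (-1 + 32 * t * (13 + t * (529 + 5148 * t)))}}.Infinite := by
  have hbad : ({0, -8 / 144, -1 / 25, -3 / 49, -8 / 140, -1 / 21, -3 / 45, -7 / 119, -5 / 95,
      -2 / 24, -2 / 37, -3 / 58, -5 / 82} ∪
      {t : ℚ | 164736 * t ^ 4 + 16928 * t ^ 3 + 416 * t ^ 2 + -1 * t + 0 = 0} ∪
      {t : ℚ | 658944 * t ^ 4 + 771600 * t ^ 3 + 119040 * t ^ 2 + 6504 * t + 120 = 0} ∪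
      {t : ℚ | 23721984 * t ^ 4 + 4459408 * t ^ 3 + 312704 * t ^ 2 + 9692 * t + 112 = 0} ∪
      {t : ℚ | 4118400 * t ^ 4 + 1291824 * t ^ 3 + 144704 * t ^ 2 + 6899 * t + 119 = 0} ∪
      {t : ℚ | 8072064 * t ^ 4 + 2027568 * t ^ 3 + 188544 * t ^ 2 + 7707 * t + 117 = 0} :
      Set ℚ).Finite := by
    refine (((((Set.toFinite _).union ?_).union ?_).union ?_).union ?_).union ?_ <;>
      exact finite_setOf_quartic_eq_zero (by norm_num)
  refine (infinite_isSquare_quintuple_cubic.sdiff hbad).mono ?_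
  rintro t ⟨⟨y, hy⟩, ht⟩
  simp only [Set.mem_union, Set.mem_insert_iff, Set.mem_singleton_iff, Set.mem_ofPred_eq,
    not_or] at ht
  obtain ⟨⟨⟨⟨⟨⟨h0, hb, hc, hd, hab, hac, had, hbc, hbd, hcd, h2, h3, h5⟩, hD⟩, hae⟩, hbe⟩, hce⟩,
    hde⟩ := ht
  have hD' : -1 + 32 * t * (13 + t * (529 + 5148 * t)) ≠ 0 := fun h => hD (by
    linear_combination t * h)
  refine isRationalDQuintuple_of_pairwise ?_ ?_ ?_ ?_ ?_ ?_ ?_ ?_ ?_ ?_ ?_ ?_ ?_ ?_ ?_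
    ⟨24 * t + 1, by ring⟩ ⟨10 * t + 1, by ring⟩ ⟨14 * t + 1, by ring⟩
    ⟨_, isSquare_mul_div_add (r := 424 * t ^ 2 + 40 * t + 1) hD' hy (by ring)⟩
    ⟨60 * t + 3, by ring⟩ ⟨84 * t + 5, by ring⟩
    ⟨_, isSquare_mul_div_add (r := 9936 * t ^ 2 + 1112 * t + 31) hD' hy (by ring)⟩
    ⟨35 * t + 2, by ring⟩
    ⟨_, isSquare_mul_div_add (r := 3868 * t ^ 2 + 414 * t + 11) hD' hy (by ring)⟩
    ⟨_, isSquare_mul_div_add (r := 5644 * t ^ 2 + 658 * t + 19) hD' hy (by ring)⟩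
  · exact mul_ne_zero four_ne_zero h0
  · exact fun h => hb (by linarith)
  · exact fun h => hc (by linarith)
  · exact fun h => hd (by linarith)
  · refine div_ne_zero (mul_ne_zero (mul_ne_zero (mul_ne_zero (by norm_num) ?_) ?_) ?_) hD'
    · exact fun h => h2 (by linarith)
    · exact fun h => h3 (by linarith)
    · exact fun h => h5 (by linarith)
  · exact fun h => hab (by linarith)
  · exact fun h => hac (by linarith)
  · exact fun h => had (by linarith)
  · exact fun h => hae (by linear_combination (eq_div_iff hD').1 h)
  · exact fun h => hbc (by linarith)
  · exact fun h => hbd (by linarith)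
  · exact fun h => hbe (by linear_combination (eq_div_iff hD').1 h)
  · exact fun h => hcd (by linarith)
  · exact fun h => hce (by linear_combination (eq_div_iff hD').1 h)
  · exact fun h => hde (by linear_combination (eq_div_iff hD').1 h)
end

section
/- Let t, r ∈ ℚ with r ≠ 0 and r² = (96721 + 16t(6521 + 2342t + 280t²))·(16t + 49). Set a₅ = 4(1+2t)(13+5t)(27+10t)(49+16t)/(96721 + 16t(6521 + 2342t + 280t²)). Then for every pair of distinct entries x, y of the list t, 9t+26, 4t+12, 16t+40, a₅, the rational number x·y + (16t+49) is a square in ℚ. In particular, whenever these five rational numbers are nonzero and pairwise distinct, the set {t, 9t+26, 4t+12, 16t+40, a₅} is a rational D(16t+49)-quintuple. -/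
/-- A list of five distinct nonzero rationals whose pairwise products plus `q` are squares
gives a rational `D(q)`-quintuple. -/
theorem isRationalDQuintuple_of_injective {q : ℚ} {a b c d e : ℚ}
    (hsq : ∀ i j : Fin 5, i ≠ j →
      ∃ z : ℚ, ![a, b, c, d, e] i * ![a, b, c, d, e] j + q = z ^ 2)
    (hinj : Function.Injective ![a, b, c, d, e]) (h0 : ∀ i : Fin 5, ![a, b, c, d, e] i ≠ 0) :
    IsRationalDQuintuple q {a, b, c, d, e} := by
  have himage : ({a, b, c, d, e} : Finset ℚ) = Finset.univ.image ![a, b, c, d, e] := by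
    ext x
    simp [Fin.exists_fin_succ, eq_comm]
  rw [himage]
  refine ⟨by simp [Finset.card_image_of_injective _ hinj], ?_, ?_⟩
  · simpa using h0
  · simp only [Finset.mem_image, Finset.mem_univ, true_and]
    rintro _ ⟨i, rfl⟩ _ ⟨j, rfl⟩ hij
    exact hsq i j (ne_of_apply_ne _ hij)

/-- If `P * q = r ^ 2` with `P ≠ 0` and `C * x + P = w ^ 2`, then the product of `x` and
`C * q / P`, plus `q`, is a square. -/
theorem mul_div_add_eq_sq {C P q r x w : ℚ} (hP : P ≠ 0) (hr : r ^ 2 = P * q)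
    (hw : C * x + P = w ^ 2) : x * (C * q / P) + q = (r * w / P) ^ 2 := by
  rw [div_pow, mul_pow, hr, ← hw]
  field_simp

/-- if `r ≠ 0` and `r² = (96721 + 16t(6521 + 2342t + 280t²))·(16t + 49)`, then with
`a₅ = 4(1+2t)(13+5t)(27+10t)(49+16t)/(96721 + 16t(6521 + 2342t + 280t²))`, any two distinct
entries of the list `t, 9t+26, 4t+12, 16t+40, a₅` have product plus `16t+49` a rational square;
in particular, when these five rationals are nonzero and pairwise distinct they form a rational
`D(16t+49)`-quintuple. -/
theorem extend_D_16t_add_49_quadruple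
    (t r : ℚ) (hr : r ≠ 0)
    (hr2 : r ^ 2 = (96721 + 16 * t * (6521 + 2342 * t + 280 * t ^ 2)) * (16 * t + 49))
    (a₅ : ℚ) (ha₅ : a₅ = 4 * (1 + 2 * t) * (13 + 5 * t) * (27 + 10 * t) * (49 + 16 * t) /
      (96721 + 16 * t * (6521 + 2342 * t + 280 * t ^ 2))) :
    (∀ i j : Fin 5, i ≠ j →
      ∃ z : ℚ, ![t, 9 * t + 26, 4 * t + 12, 16 * t + 40, a₅] i *
        ![t, 9 * t + 26, 4 * t + 12, 16 * t + 40, a₅] j + (16 * t + 49) = z ^ 2) ∧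
    ((Function.Injective ![t, 9 * t + 26, 4 * t + 12, 16 * t + 40, a₅] ∧
        ∀ i : Fin 5, ![t, 9 * t + 26, 4 * t + 12, 16 * t + 40, a₅] i ≠ 0) →
      IsRationalDQuintuple (16 * t + 49)
        {t, 9 * t + 26, 4 * t + 12, 16 * t + 40, a₅}) := by
  have hP : 96721 + 16 * t * (6521 + 2342 * t + 280 * t ^ 2) ≠ 0 := by
    intro h
    rw [h, zero_mul] at hr2
    exact hr (pow_eq_zero_iff two_ne_zero |>.mp hr2)
  have hsq : ∀ i j : Fin 5, i < j →
      ∃ z : ℚ, ![t, 9 * t + 26, 4 * t + 12, 16 * t + 40, a₅] i *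
        ![t, 9 * t + 26, 4 * t + 12, 16 * t + 40, a₅] j + (16 * t + 49) = z ^ 2 := by
    have h01 : t * (9 * t + 26) + (16 * t + 49) = (3 * t + 7) ^ 2 := by ring
    have h02 : t * (4 * t + 12) + (16 * t + 49) = (2 * t + 7) ^ 2 := by ring
    have h03 : t * (16 * t + 40) + (16 * t + 49) = (4 * t + 7) ^ 2 := by ring
    have h12 : (9 * t + 26) * (4 * t + 12) + (16 * t + 49) = (6 * t + 19) ^ 2 := by ring
    have h13 : (9 * t + 26) * (16 * t + 40) + (16 * t + 49) = (12 * t + 33) ^ 2 := by ring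
    have h23 : (4 * t + 12) * (16 * t + 40) + (16 * t + 49) = (8 * t + 23) ^ 2 := by ring
    have hlast {x w : ℚ} (hw : 4 * (1 + 2 * t) * (13 + 5 * t) * (27 + 10 * t) * x +
        (96721 + 16 * t * (6521 + 2342 * t + 280 * t ^ 2)) = w ^ 2) :
        ∃ z : ℚ, x * a₅ + (16 * t + 49) = z ^ 2 := by
      rw [ha₅, add_comm 49 (16 * t)]
      exact ⟨_, mul_div_add_eq_sq hP hr2 hw⟩
    have h04 := hlast (x := t) (w := 20 * t ^ 2 + 170 * t + 311) (by ring)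
    have h14 := hlast (x := 9 * t + 26) (w := 60 * t ^ 2 + 298 * t + 365) (by ring)
    have h24 := hlast (x := 4 * t + 12) (w := 40 * t ^ 2 + 232 * t + 337) (by ring)
    have h34 := hlast (x := 16 * t + 40) (w := 80 * t ^ 2 + 360 * t + 391) (by ring)
    intro i j hij
    fin_cases i <;> fin_cases j <;>
      first
      | exact absurd hij (by decide)
      | exact ⟨_, h01⟩
      | exact ⟨_, h02⟩
      | exact ⟨_, h03⟩
      | exact ⟨_, h12⟩
      | exact ⟨_, h13⟩
      | exact ⟨_, h23⟩
      | exact h04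
      | exact h14
      | exact h24
      | exact h34
  have hall : ∀ i j : Fin 5, i ≠ j →
      ∃ z : ℚ, ![t, 9 * t + 26, 4 * t + 12, 16 * t + 40, a₅] i *
        ![t, 9 * t + 26, 4 * t + 12, 16 * t + 40, a₅] j + (16 * t + 49) = z ^ 2 := by
    intro i j hij
    rcases lt_or_gt_of_ne hij with h | h
    · exact hsq i j h
    · rw [mul_comm]
      exact hsq j i h
  exact ⟨hall, fun h => isRationalDQuintuple_of_injective hall h.1 h.2⟩
end

section
/- There exist infinitely many t ∈ ℚ such that the set {t, 9t+26, 4t+12, 16t+40, 4(1+2t)(13+5t)(27+10t)(49+16t)/(96721 + 16t(6521 + 2342t + 280t²))} is a rational D(16t+49)-quintuple. -/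
open Polynomial in
/-- The values of `t` for which two elements of the family coincide, or one of them is `0`, are
among the zeros of a nonzero polynomial. -/
lemma finite_degenerate_parameters :
    {t : ℚ | t * (9 * t + 26) * (4 * t + 12) * (16 * t + 40) *
      (8 * t + 26) * (3 * t + 12) * (15 * t + 40) * (5 * t + 14) * (7 * t + 14) * (12 * t + 28) *
      (4 * (1 + 2 * t) * (13 + 5 * t) * (27 + 10 * t) * (49 + 16 * t)) *
      (96721 + 16 * t * (6521 + 2342 * t + 280 * t ^ 2)) *
      (4 * (1 + 2 * t) * (13 + 5 * t) * (27 + 10 * t) * (49 + 16 * t) -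
        t * (96721 + 16 * t * (6521 + 2342 * t + 280 * t ^ 2))) *
      (4 * (1 + 2 * t) * (13 + 5 * t) * (27 + 10 * t) * (49 + 16 * t) -
        (9 * t + 26) * (96721 + 16 * t * (6521 + 2342 * t + 280 * t ^ 2))) *
      (4 * (1 + 2 * t) * (13 + 5 * t) * (27 + 10 * t) * (49 + 16 * t) -
        (4 * t + 12) * (96721 + 16 * t * (6521 + 2342 * t + 280 * t ^ 2))) *
      (4 * (1 + 2 * t) * (13 + 5 * t) * (27 + 10 * t) * (49 + 16 * t) -
        (16 * t + 40) * (96721 + 16 * t * (6521 + 2342 * t + 280 * t ^ 2))) = 0}.Finite := by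
  let N : ℚ[X] := 4 * (1 + 2 * X) * (13 + 5 * X) * (27 + 10 * X) * (49 + 16 * X)
  let D : ℚ[X] := 96721 + 16 * X * (6521 + 2342 * X + 280 * X ^ 2)
  let P : ℚ[X] := X * (9 * X + 26) * (4 * X + 12) * (16 * X + 40) *
    (8 * X + 26) * (3 * X + 12) * (15 * X + 40) * (5 * X + 14) * (7 * X + 14) * (12 * X + 28) *
    N * D * (N - X * D) * (N - (9 * X + 26) * D) * (N - (4 * X + 12) * D) *
    (N - (16 * X + 40) * D)
  have hP : P ≠ 0 := by
    intro h
    have h1 := congrArg (Polynomial.eval 1) h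
    norm_num [P, N, D] at h1
  refine (Polynomial.finite_setOfPred_isRoot hP).subset fun t ht => ?_
  simp only [Set.mem_ofPred_eq, Polynomial.IsRoot.def] at ht ⊢
  rw [← ht]
  simp [P, N, D]

/-- Away from the degenerate parameters, the family is a `D(16t+49)`-quintuple as soon as the
product of `16t+49` and the denominator of the fifth element is a square. -/
lemma isRationalDQuintuple_of_sq {t w : ℚ}
    (hw : (16 * t + 49) * (96721 + 16 * t * (6521 + 2342 * t + 280 * t ^ 2)) = w ^ 2)
    (ht : t * (9 * t + 26) * (4 * t + 12) * (16 * t + 40) *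
      (8 * t + 26) * (3 * t + 12) * (15 * t + 40) * (5 * t + 14) * (7 * t + 14) * (12 * t + 28) *
      (4 * (1 + 2 * t) * (13 + 5 * t) * (27 + 10 * t) * (49 + 16 * t)) *
      (96721 + 16 * t * (6521 + 2342 * t + 280 * t ^ 2)) *
      (4 * (1 + 2 * t) * (13 + 5 * t) * (27 + 10 * t) * (49 + 16 * t) -
        t * (96721 + 16 * t * (6521 + 2342 * t + 280 * t ^ 2))) *
      (4 * (1 + 2 * t) * (13 + 5 * t) * (27 + 10 * t) * (49 + 16 * t) -
        (9 * t + 26) * (96721 + 16 * t * (6521 + 2342 * t + 280 * t ^ 2))) *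
      (4 * (1 + 2 * t) * (13 + 5 * t) * (27 + 10 * t) * (49 + 16 * t) -
        (4 * t + 12) * (96721 + 16 * t * (6521 + 2342 * t + 280 * t ^ 2))) *
      (4 * (1 + 2 * t) * (13 + 5 * t) * (27 + 10 * t) * (49 + 16 * t) -
        (16 * t + 40) * (96721 + 16 * t * (6521 + 2342 * t + 280 * t ^ 2))) ≠ 0) :
    IsRationalDQuintuple (16 * t + 49)
      {t, 9 * t + 26, 4 * t + 12, 16 * t + 40,
        4 * (1 + 2 * t) * (13 + 5 * t) * (27 + 10 * t) * (49 + 16 * t) /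
          (96721 + 16 * t * (6521 + 2342 * t + 280 * t ^ 2))} := by
  obtain ⟨D, hD⟩ : ∃ D, D = 96721 + 16 * t * (6521 + 2342 * t + 280 * t ^ 2) := ⟨_, rfl⟩
  obtain ⟨N, hN⟩ : ∃ N, N = 4 * (1 + 2 * t) * (13 + 5 * t) * (27 + 10 * t) * (49 + 16 * t) :=
    ⟨_, rfl⟩
  rw [← hD] at hw
  rw [← hD, ← hN] at ht ⊢
  simp only [mul_ne_zero_iff, sub_ne_zero] at ht
  obtain ⟨⟨⟨⟨⟨⟨⟨⟨⟨⟨⟨⟨⟨⟨⟨h1, h2⟩, h3⟩, h4⟩, h12⟩, h13⟩, h14⟩, h23⟩, h24⟩, h34⟩, hN0⟩, hD0⟩,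
    h15⟩, h25⟩, h35⟩, h45⟩ := ht
  have h5 : N / D ≠ 0 := div_ne_zero hN0 hD0
  have n12 : t ≠ 9 * t + 26 := fun h => h12 (by linarith)
  have n13 : t ≠ 4 * t + 12 := fun h => h13 (by linarith)
  have n14 : t ≠ 16 * t + 40 := fun h => h14 (by linarith)
  have n23 : 9 * t + 26 ≠ 4 * t + 12 := fun h => h23 (by linarith)
  have n24 : 9 * t + 26 ≠ 16 * t + 40 := fun h => h24 (by linarith)
  have n34 : 4 * t + 12 ≠ 16 * t + 40 := fun h => h34 (by linarith)
  have n15 : t ≠ N / D := fun h => h15 ((eq_div_iff hD0).1 h).symm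
  have n25 : 9 * t + 26 ≠ N / D := fun h => h25 ((eq_div_iff hD0).1 h).symm
  have n35 : 4 * t + 12 ≠ N / D := fun h => h35 ((eq_div_iff hD0).1 h).symm
  have n45 : 16 * t + 40 ≠ N / D := fun h => h45 ((eq_div_iff hD0).1 h).symm
  have fifth {a R : ℚ} (h : a * (4 * (1 + 2 * t) * (13 + 5 * t) * (27 + 10 * t)) + D = R ^ 2) :
      a * (N / D) + (16 * t + 49) = (w * R / D) ^ 2 := by
    rw [div_pow, mul_pow, ← hw, ← h, hN]
    field_simp
    ring
  have e12 : t * (9 * t + 26) + (16 * t + 49) = (3 * t + 7) ^ 2 := by ring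
  have e13 : t * (4 * t + 12) + (16 * t + 49) = (2 * t + 7) ^ 2 := by ring
  have e14 : t * (16 * t + 40) + (16 * t + 49) = (4 * t + 7) ^ 2 := by ring
  have e23 : (9 * t + 26) * (4 * t + 12) + (16 * t + 49) = (6 * t + 19) ^ 2 := by ring
  have e24 : (9 * t + 26) * (16 * t + 40) + (16 * t + 49) = (12 * t + 33) ^ 2 := by ring
  have e34 : (4 * t + 12) * (16 * t + 40) + (16 * t + 49) = (8 * t + 23) ^ 2 := by ring
  have e15 := fifth (a := t) (R := 20 * t ^ 2 + 170 * t + 311) (by rw [hD]; ring)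
  have e25 := fifth (a := 9 * t + 26) (R := 60 * t ^ 2 + 298 * t + 365) (by rw [hD]; ring)
  have e35 := fifth (a := 4 * t + 12) (R := 40 * t ^ 2 + 232 * t + 337) (by rw [hD]; ring)
  have e45 := fifth (a := 16 * t + 40) (R := 80 * t ^ 2 + 360 * t + 391) (by rw [hD]; ring)
  refine ⟨?_, ?_, ?_⟩
  · rw [Finset.card_insert_of_notMem, Finset.card_insert_of_notMem,
      Finset.card_insert_of_notMem, Finset.card_insert_of_notMem, Finset.card_singleton] <;>
    simp only [Finset.mem_insert, Finset.mem_singleton, not_or] <;> tauto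
  · simp only [Finset.mem_insert, Finset.mem_singleton]
    rintro x (rfl | rfl | rfl | rfl | rfl) <;> assumption
  · intro x hx y hy hxy
    simp only [Finset.mem_insert, Finset.mem_singleton] at hx hy
    rcases hx with hx | hx | hx | hx | hx <;> rcases hy with hy | hy | hy | hy | hy <;>
      rw [hx, hy] at hxy ⊢ <;>
      first
      | exact absurd rfl hxy
      | exact ⟨_, by assumption⟩
      | exact ⟨_, by rw [mul_comm]; assumption⟩

/-- The abscissa of the double of a point on `2v² = -1287u³ + 1745u² - 461u + 35`. -/
lemma exists_sq_of_double {u v : ℚ}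
    (h : -1287 * u ^ 3 + 1745 * u ^ 2 - 461 * u + 35 = 2 * v ^ 2) (hv : v ≠ 0) :
    ∃ v' : ℚ, ∀ u' : ℚ, u' = ((-3861 * u ^ 2 + 3490 * u - 461) ^ 2 -
        4 * (-1287 * u ^ 3 + 1745 * u ^ 2 - 461 * u + 35) * (1745 - 2574 * u)) /
        (-5148 * (-1287 * u ^ 3 + 1745 * u ^ 2 - 461 * u + 35)) →
      -1287 * u' ^ 3 + 1745 * u' ^ 2 - 461 * u' + 35 = 2 * v' ^ 2 := by
  obtain ⟨l, hl⟩ : ∃ l, l = (-3861 * u ^ 2 + 3490 * u - 461) / (4 * v) := ⟨_, rfl⟩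
  have hl' : 4 * v * l = -3861 * u ^ 2 + 3490 * u - 461 := by rw [hl]; field_simp
  refine ⟨v + l * ((1745 - 2 * l ^ 2) / 1287 - 2 * u - u), ?_⟩
  rintro u' hu
  have hu' : u' = (1745 - 2 * l ^ 2) / 1287 - 2 * u := by
    rw [hu, ← hl', h]
    field_simp
    ring
  rw [← hu']
  have key : 1287 * u' = 1745 - 2 * l ^ 2 - 2574 * u := by rw [hu']; ring
  linear_combination h - (u' - u) * hl' - (u' - u) ^ 2 * key

/-- Points on `2v² = -1287u³ + 1745u² - 461u + 35` whose abscissa is `2`-adically arbitrarily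
large. -/
lemma exists_point_two_pow_dvd (n : ℕ) :
    ∃ p m : ℤ, Odd p ∧ m ≠ 0 ∧ 2 ^ (n + 1) ∣ m ∧
      ∃ v : ℚ, -1287 * (p / m : ℚ) ^ 3 + 1745 * (p / m : ℚ) ^ 2 - 461 * (p / m : ℚ) + 35 =
        2 * v ^ 2 := by
  induction n with
  | zero => exact ⟨1, 8, by decide, by decide, by decide, 33 / 32, by norm_num⟩
  | succ n ih =>
    obtain ⟨p, m, hp, hm, hd, v, hv⟩ := ih
    have hme : Even m := even_iff_two_dvd.2 ((dvd_pow_self 2 n.succ_ne_zero).trans hd)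
    obtain ⟨H, hH⟩ : ∃ H, H = -1287 * p ^ 3 + 1745 * p ^ 2 * m - 461 * p * m ^ 2 + 35 * m ^ 3 :=
      ⟨_, rfl⟩
    have hHo : Odd H := by
      rw [hH, show -1287 * p ^ 3 + 1745 * p ^ 2 * m - 461 * p * m ^ 2 + 35 * m ^ 3 =
        -1287 * p ^ 3 + m * (1745 * p ^ 2 - 461 * p * m + 35 * m ^ 2) by ring]
      exact ((by decide : Odd (-1287 : ℤ)).mul hp.pow).add_even (hme.mul_right _)
    have hH0 : H ≠ 0 := by rintro rfl; exact absurd hHo (by decide)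
    have hmq : (m : ℚ) ≠ 0 := by exact_mod_cast hm
    have hHq : (H : ℚ) ≠ 0 := by exact_mod_cast hH0
    have hhH : -1287 * (p / m : ℚ) ^ 3 + 1745 * (p / m : ℚ) ^ 2 - 461 * (p / m : ℚ) + 35 =
        H / m ^ 3 := by
      rw [hH]; push_cast; field_simp
    have hv0 : v ≠ 0 := by
      rintro rfl
      rw [hhH] at hv
      norm_num [hmq, hHq] at hv
    obtain ⟨v', hv'⟩ := exists_sq_of_double hv hv0
    refine ⟨(-3861 * p ^ 2 + 3490 * p * m - 461 * m ^ 2) ^ 2 - 4 * (H * (1745 * m - 2574 * p)),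
      -5148 * (m * H), ?_, by simp [hm, hH0], ?_, v', hv' _ ?_⟩
    · rw [show -3861 * p ^ 2 + 3490 * p * m - 461 * m ^ 2 =
        -3861 * p ^ 2 + m * (3490 * p - 461 * m) by ring]
      exact (((by decide : Odd (-3861 : ℤ)).mul hp.pow).add_even (hme.mul_right _)).pow.sub_even
        ((by decide : Even (4 : ℤ)).mul_right _)
    · obtain ⟨k, rfl⟩ := hd
      exact ⟨-2574 * (k * H), by ring⟩
    · rw [hhH]
      push_cast
      field_simp

lemma infinite_setOf_sq :
    {t : ℚ | ∃ w : ℚ, (16 * t + 49) * (96721 + 16 * t * (6521 + 2342 * t + 280 * t ^ 2)) =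
      w ^ 2}.Infinite := by
  have hU : {u : ℚ | u ≠ 0 ∧ ∃ v : ℚ,
      -1287 * u ^ 3 + 1745 * u ^ 2 - 461 * u + 35 = 2 * v ^ 2}.Infinite := by
    refine Set.Infinite.of_image Rat.den (Set.infinite_of_not_bddAbove ?_)
    rintro ⟨B, hB⟩
    obtain ⟨p, m, hp, hm, hd, hv⟩ := exists_point_two_pow_dvd B
    have hmq : (m : ℚ) ≠ 0 := by exact_mod_cast hm
    have hp0 : (p : ℚ) ≠ 0 := by
      norm_cast
      rintro rfl
      exact absurd hp (by decide)
    have hle := hB ⟨(p / m : ℚ), ⟨div_ne_zero hp0 hmq, hv⟩, rfl⟩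
    obtain ⟨u, hu⟩ : ∃ u : ℚ, u = p / m := ⟨_, rfl⟩
    rw [← hu] at hle
    have hcross : (u.den : ℤ) * p = u.num * m := by
      have : (u.num : ℚ) / u.den = p / m := by rw [Rat.num_div_den, hu]
      rw [div_eq_div_iff (by exact_mod_cast u.den_ne_zero) hmq] at this
      rw [mul_comm]
      exact_mod_cast this.symm
    have hdvd : (2 : ℤ) ^ (B + 1) ∣ u.den := by
      refine IsCoprime.dvd_of_dvd_mul_right ?_ (hcross ▸ hd.mul_left _)
      exact (Int.isCoprime_two_left.2 hp).pow_left
    have hdvd' : 2 ^ (B + 1) ∣ u.den := by exact_mod_cast hdvd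
    have := Nat.le_of_dvd u.den_pos hdvd'
    have := Nat.lt_two_pow_self (n := B + 1)
    omega
  have hinj : Set.InjOn (fun u : ℚ => (u⁻¹ - 49) / 16) {u : ℚ | u ≠ 0 ∧ ∃ v : ℚ,
      -1287 * u ^ 3 + 1745 * u ^ 2 - 461 * u + 35 = 2 * v ^ 2} := by
    intro a _ b _ h
    have h' : (a⁻¹ - 49) / 16 = (b⁻¹ - 49) / 16 := h
    exact inv_injective (by linarith)
  refine (hU.image hinj).mono ?_
  rintro _ ⟨u, ⟨hu, v, hv⟩, rfl⟩
  refine ⟨v / (4 * u ^ 2), ?_⟩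
  have hs : (v / (4 * u ^ 2)) ^ 2 =
      (-1287 * u ^ 3 + 1745 * u ^ 2 - 461 * u + 35) / (32 * u ^ 4) := by
    rw [hv]; field_simp; ring
  rw [hs]
  field_simp
  ring

/-- there are infinitely many `t ∈ ℚ` such that
`{t, 9t+26, 4t+12, 16t+40, 4(1+2t)(13+5t)(27+10t)(49+16t)/(96721 + 16t(6521 + 2342t + 280t²))}`
is a rational `D(16t+49)`-quintuple. -/
theorem infinitely_many_D_16t_add_49_quintuples :
    {t : ℚ | IsRationalDQuintuple (16 * t + 49)
      {t, 9 * t + 26, 4 * t + 12, 16 * t + 40,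
        4 * (1 + 2 * t) * (13 + 5 * t) * (27 + 10 * t) * (49 + 16 * t) /
          (96721 + 16 * t * (6521 + 2342 * t + 280 * t ^ 2))}}.Infinite := by
  refine (infinite_setOf_sq.sdiff finite_degenerate_parameters).mono ?_
  rintro t ⟨⟨w, hw⟩, ht⟩
  exact isRationalDQuintuple_of_sq hw ht
end

section
/- Let t, r ∈ ℚ with r ≠ 0 and r² = (81 + 2t(62 + t(31 + 5t)))·(9 + 4t). Set a₅ = (2+t)(9+4t)(8+5t)(14+5t)/(324 + 8t(62 + t(31 + 5t))). Then for every pair of distinct entries x, y of the list t, t/4 − 1, 9t/4 + 5, 4t + 8, a₅, the rational number x·y + (4t+9) is a square in ℚ. In particular, whenever these five rational numbers are nonzero and pairwise distinct, the set {t, t/4 − 1, 9t/4 + 5, 4t + 8, a₅} is a rational D(4t+9)-quintuple. -/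
/-- An injective nonvanishing family `Fin 5 → ℚ` whose pairwise products plus `q` are squares has
a rational `D(q)`-quintuple as its image. -/
theorem isRationalDQuintuple_image {q : ℚ} {f : Fin 5 → ℚ} (hf : Function.Injective f)
    (h0 : ∀ i, f i ≠ 0) (h : ∀ i j, i ≠ j → ∃ z : ℚ, f i * f j + q = z ^ 2) :
    IsRationalDQuintuple q (Finset.univ.image f) := by
  refine ⟨by simp [Finset.card_image_of_injective _ hf], by simpa using h0, ?_⟩
  simp only [Finset.mem_image, Finset.mem_univ, true_and]
  rintro _ ⟨i, rfl⟩ _ ⟨j, rfl⟩ hij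
  exact h i j fun e => hij (congrArg f e)

/-- If `p * q = r ^ 2` and `m * x + 4 * p = b ^ 2`, then `x * (q * m / (4 * p)) + q` is a
square. -/
theorem exists_sq_of_mul_add_four_mul {p q r m x b : ℚ} (hp : p ≠ 0) (hr : r ^ 2 = p * q)
    (hb : m * x + 4 * p = b ^ 2) : ∃ z : ℚ, x * (q * m / (4 * p)) + q = z ^ 2 := by
  refine ⟨r * b / (2 * p), ?_⟩
  rw [div_pow, mul_pow, hr, ← hb]
  field_simp
  ring

/-- A symmetric relation on a family indexed by `Fin 5` holds for all pairs of distinct indices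
once it holds for increasing pairs. -/
theorem forall_ne_of_forall_lt {R : Fin 5 → Fin 5 → Prop} (hs : ∀ i j, R i j → R j i)
    (h : ∀ i j, i < j → R i j) (i j : Fin 5) (hij : i ≠ j) : R i j :=
  hij.lt_or_gt.elim (h i j) fun hji => hs j i (h j i hji)

/-- if `r ≠ 0` and `r² = (81 + 2t(62 + t(31 + 5t)))·(9 + 4t)`, then with
`a₅ = (2+t)(9+4t)(8+5t)(14+5t)/(324 + 8t(62 + t(31 + 5t)))`, any two distinct entries of the list
`t, t/4 − 1, 9t/4 + 5, 4t + 8, a₅` have product plus `4t+9` a rational square; in particular,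
when these five rationals are nonzero and pairwise distinct they form a rational
`D(4t+9)`-quintuple. -/
theorem extend_D_4t_add_9_quadruple
    (t r : ℚ) (hr : r ≠ 0)
    (hr2 : r ^ 2 = (81 + 2 * t * (62 + t * (31 + 5 * t))) * (9 + 4 * t))
    (a₅ : ℚ) (ha₅ : a₅ = (2 + t) * (9 + 4 * t) * (8 + 5 * t) * (14 + 5 * t) /
      (324 + 8 * t * (62 + t * (31 + 5 * t)))) :
    (∀ i j : Fin 5, i ≠ j →
      ∃ z : ℚ, ![t, t / 4 - 1, 9 * t / 4 + 5, 4 * t + 8, a₅] i *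
        ![t, t / 4 - 1, 9 * t / 4 + 5, 4 * t + 8, a₅] j + (4 * t + 9) = z ^ 2) ∧
    ((Function.Injective ![t, t / 4 - 1, 9 * t / 4 + 5, 4 * t + 8, a₅] ∧
        ∀ i : Fin 5, ![t, t / 4 - 1, 9 * t / 4 + 5, 4 * t + 8, a₅] i ≠ 0) →
      IsRationalDQuintuple (4 * t + 9)
        {t, t / 4 - 1, 9 * t / 4 + 5, 4 * t + 8, a₅}) := by
  set p : ℚ := 81 + 2 * t * (62 + t * (31 + 5 * t)) with hp_def
  have hp : p ≠ 0 := by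
    rintro hp
    rw [hp, zero_mul] at hr2
    exact hr (pow_eq_zero_iff two_ne_zero |>.mp hr2)
  have ha : a₅ = (9 + 4 * t) * ((2 + t) * (8 + 5 * t) * (14 + 5 * t)) / (4 * p) := by
    rw [ha₅, hp_def]
    congr 1 <;> ring
  have key {x : ℚ} (b : ℚ)
      (hb : (2 + t) * (8 + 5 * t) * (14 + 5 * t) * x + 4 * p = b ^ 2) :
      ∃ z : ℚ, x * a₅ + (4 * t + 9) = z ^ 2 := by
    rw [ha, add_comm (4 * t)]
    exact exists_sq_of_mul_add_four_mul hp hr2 hb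
  have hsq : ∀ i j : Fin 5, i ≠ j →
      ∃ z : ℚ, ![t, t / 4 - 1, 9 * t / 4 + 5, 4 * t + 8, a₅] i *
        ![t, t / 4 - 1, 9 * t / 4 + 5, 4 * t + 8, a₅] j + (4 * t + 9) = z ^ 2 := by
    apply forall_ne_of_forall_lt
    · rintro i j ⟨z, hz⟩
      exact ⟨z, by rw [mul_comm, hz]⟩
    · intro i j hij
      fin_cases i <;> fin_cases j <;> first | exact absurd hij (by decide) | skip
      · exact ⟨t / 2 + 3, by simp; ring⟩
      · exact ⟨3 * t / 2 + 3, by simp; ring⟩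
      · exact ⟨2 * t + 3, by simp; ring⟩
      · exact key (5 * t ^ 2 + 20 * t + 18) (by simp [hp_def]; ring)
      · exact ⟨3 * t / 4 + 2, by simp; ring⟩
      · exact ⟨t + 1, by simp; ring⟩
      · exact key ((5 * t ^ 2 + 22 * t + 20) / 2) (by simp [hp_def]; ring)
      · exact ⟨3 * t + 7, by simp; ring⟩
      · exact key ((15 * t ^ 2 + 70 * t + 76) / 2) (by simp [hp_def]; ring)
      · exact key (10 * t ^ 2 + 44 * t + 46) (by simp [hp_def]; ring)
  refine ⟨hsq, fun ⟨hinj, h0⟩ => ?_⟩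
  convert isRationalDQuintuple_image hinj h0 hsq using 1
  ext x
  simp [Fin.exists_fin_succ, eq_comm]
end

section
/- There exist infinitely many t ∈ ℚ such that the set {t, t/4 − 1, 9t/4 + 5, 4t + 8, (2+t)(9+4t)(8+5t)(14+5t)/(324 + 8t(62 + t(31 + 5t)))} is a rational D(4t+9)-quintuple. -/
/-- One step of Horner's scheme for a monic integer polynomial at a rational that is not
`p`-integral. -/
lemma padicNorm_mul_add_intCast {p : ℕ} [Fact p.Prime] {x h : ℚ} (hx : 1 < padicNorm p x)
    (hh : 1 ≤ padicNorm p h) (c : ℤ) :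
    padicNorm p (x * h + c) = padicNorm p x * padicNorm p h := by
  have hc : padicNorm p (c : ℚ) ≤ 1 := padicNorm.of_int c
  have hxh : 1 < padicNorm p x * padicNorm p h := by nlinarith
  rw [padicNorm.add_eq_max_of_ne (by rw [padicNorm.mul]; exact (hc.trans_lt hxh).ne'),
    padicNorm.mul, max_eq_left (hc.trans hxh.le)]

/-- The elliptic curve `y² = x³ - 11x² - 185x + 2391`. -/
def curveCubic (x : ℚ) : ℚ := x ^ 3 - 11 * x ^ 2 - 185 * x + 2391

/-- The `x`-coordinate of the double of a point on the curve `y² = curveCubic x`. -/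
def doubleX (x : ℚ) : ℚ :=
  (x ^ 4 + 370 * x ^ 2 - 19128 * x + 139429) / (4 * curveCubic x)

lemma padicNorm_curveCubic {x : ℚ} (hx : 1 < padicNorm 2 x) :
    padicNorm 2 (curveCubic x) = padicNorm 2 x ^ 3 := by
  have h₁ := padicNorm_mul_add_intCast (h := 1) hx padicNorm.one.ge (-11)
  rw [mul_one, padicNorm.one, mul_one] at h₁
  have h₂ := padicNorm_mul_add_intCast hx (h₁.ge.trans' hx.le) (-185)
  have h₃ := padicNorm_mul_add_intCast hx (by rw [h₂, h₁]; nlinarith) 2391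
  rw [h₂, h₁] at h₃
  convert h₃ using 1
  · congr 1
    simp only [curveCubic]
    push_cast
    ring
  · ring

lemma padicNorm_doubleX {x : ℚ} (hx : 1 < padicNorm 2 x) :
    padicNorm 2 (doubleX x) = 4 * padicNorm 2 x := by
  have h₁ := padicNorm_mul_add_intCast (h := 1) hx padicNorm.one.ge 0
  rw [mul_one, padicNorm.one, mul_one] at h₁
  have h₂ := padicNorm_mul_add_intCast hx (h₁.ge.trans' hx.le) 370
  rw [h₁] at h₂
  have h₃ := padicNorm_mul_add_intCast hx (by rw [h₂]; nlinarith) (-19128)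
  rw [h₂] at h₃
  have h₄ := padicNorm_mul_add_intCast hx (by
    rw [h₃]
    exact one_le_mul_of_one_le_of_one_le hx.le (one_le_mul_of_one_le_of_one_le hx.le hx.le)) 139429
  rw [h₃] at h₄
  have hnum : x ^ 4 + 370 * x ^ 2 - 19128 * x + 139429 =
      x * (x * (x * (x + (0 : ℤ)) + (370 : ℤ)) + (-19128 : ℤ)) + (139429 : ℤ) := by
    push_cast
    ring
  have hfour : padicNorm 2 (4 : ℚ) = 1 / 4 := by
    rw [show (4 : ℚ) = (2 : ℕ) * (2 : ℕ) by norm_num, padicNorm.mul,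
      padicNorm.padicNorm_p_of_prime]
    norm_num
  have hx₀ : padicNorm 2 x ≠ 0 := (zero_lt_one.trans hx).ne'
  rw [doubleX, padicNorm.div, padicNorm.mul, padicNorm_curveCubic hx, hfour, hnum, h₄]
  field_simp

lemma isSquare_curveCubic_doubleX {x : ℚ} (h₀ : curveCubic x ≠ 0)
    (h : IsSquare (curveCubic x)) : IsSquare (curveCubic (doubleX x)) := by
  have key : curveCubic (doubleX x) =
      (x ^ 6 - 22 * x ^ 5 - 925 * x ^ 4 + 47820 * x ^ 3 - 697145 * x ^ 2 + 4836778 * x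
        - 19940683) ^ 2 / (64 * curveCubic x ^ 3) := by
    rw [doubleX, curveCubic]
    generalize hg : curveCubic x = g at h₀
    field_simp
    rw [← hg, curveCubic]
    ring
  obtain ⟨y, hy⟩ := h
  rw [key, hy]
  exact ⟨(x ^ 6 - 22 * x ^ 5 - 925 * x ^ 4 + 47820 * x ^ 3 - 697145 * x ^ 2 + 4836778 * x
    - 19940683) / (8 * y ^ 3), by rw [div_mul_div_comm]; ring⟩

lemma infinite_setOf_isSquare_curveCubic : {x : ℚ | IsSquare (curveCubic x)}.Infinite := by
  have hstart : padicNorm 2 (6397 / 4 : ℚ) = 4 := by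
    rw [show (6397 / 4 : ℚ) = (6397 : ℕ) / ((2 : ℕ) * (2 : ℕ)) by norm_num, padicNorm.div,
      padicNorm.mul, padicNorm.padicNorm_p_of_prime,
      (padicNorm.nat_eq_one_iff (p := 2) 6397).2 (by norm_num)]
    norm_num
  have hnorm (n : ℕ) : padicNorm 2 (doubleX^[n] (6397 / 4)) = 4 ^ (n + 1) := by
    induction n with
    | zero => simpa using hstart
    | succ n ih =>
      rw [Function.iterate_succ_apply', padicNorm_doubleX, ih]
      · ring
      · rw [ih]
        exact one_lt_pow₀ (by norm_num) n.succ_ne_zero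
  refine Set.infinite_of_injective_forall_mem (f := fun n : ℕ => doubleX^[n] (6397 / 4))
    (fun m n hmn => ?_) fun n => ?_
  · have h := congrArg (padicNorm 2) hmn
    simp only [hnorm] at h
    have := pow_right_injective₀ (by norm_num : (0 : ℚ) < 4) (by norm_num) h
    omega
  · change IsSquare _
    induction n with
    | zero => exact ⟨509859 / 8, by norm_num [curveCubic]⟩
    | succ n ih =>
      rw [Function.iterate_succ_apply']
      refine isSquare_curveCubic_doubleX (fun h => ?_) ih
      have hlt : 1 < padicNorm 2 (doubleX^[n] (6397 / 4)) := by
        rw [hnorm]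
        exact one_lt_pow₀ (by norm_num) n.succ_ne_zero
      have h' := padicNorm_curveCubic hlt
      rw [h, padicNorm.zero] at h'
      exact pow_ne_zero 3 (zero_lt_one.trans hlt).ne' h'.symm

/-- The denominator of the fifth element of the quintuple. -/
def fifthDen (t : ℚ) : ℚ := 324 + 8 * t * (62 + t * (31 + 5 * t))

lemma infinite_setOf_isSquare_mul_fifthDen :
    {t : ℚ | IsSquare ((9 + 4 * t) * fifthDen t)}.Infinite := by
  have hinj : Function.Injective fun x : ℚ => (63 * (2 * x + 1)⁻¹ - 9) / 4 := by
    intro x y h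
    have h' : (2 * x + 1)⁻¹ = (2 * y + 1)⁻¹ := by
      simp only at h
      linarith
    linarith [inv_injective h']
  refine (infinite_setOf_isSquare_curveCubic.image hinj.injOn).mono ?_
  rintro _ ⟨x, ⟨y, hy⟩, rfl⟩
  refine ⟨63 * y * (2 * x + 1)⁻¹ ^ 2, ?_⟩
  rcases eq_or_ne (2 * x + 1) 0 with h₀ | h₀
  · norm_num [h₀]
  · have hrw : 63 * y * (2 * x + 1)⁻¹ ^ 2 * (63 * y * (2 * x + 1)⁻¹ ^ 2) =
        3969 * curveCubic x * (2 * x + 1)⁻¹ ^ 4 := by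
      rw [hy]
      ring
    rw [hrw]
    simp only [fifthDen, curveCubic]
    field_simp
    ring

/-- The numerator of the fifth element of the quintuple. -/
def fifthNum (t : ℚ) : ℚ := (2 + t) * (9 + 4 * t) * (8 + 5 * t) * (14 + 5 * t)

/-- A polynomial that vanishes wherever the five elements fail to be distinct and nonzero. -/
def degeneracy (t : ℚ) : ℚ :=
  t * (t / 4 - 1) * (9 * t / 4 + 5) * (4 * t + 8) * fifthNum t * fifthDen t *
  (t - (t / 4 - 1)) * (t - (9 * t / 4 + 5)) * (t - (4 * t + 8)) *
  (t / 4 - 1 - (9 * t / 4 + 5)) * (t / 4 - 1 - (4 * t + 8)) * (9 * t / 4 + 5 - (4 * t + 8)) *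
  (t * fifthDen t - fifthNum t) * ((t / 4 - 1) * fifthDen t - fifthNum t) *
  ((9 * t / 4 + 5) * fifthDen t - fifthNum t) * ((4 * t + 8) * fifthDen t - fifthNum t)

open Polynomial in
lemma finite_setOf_degeneracy_eq_zero : {t : ℚ | degeneracy t = 0}.Finite := by
  let D : ℚ[X] := 324 + 8 * X * (62 + X * (31 + 5 * X))
  let N : ℚ[X] := (2 + X) * (9 + 4 * X) * (8 + 5 * X) * (14 + 5 * X)
  let b : ℚ[X] := C (1 / 4) * X - 1
  let c : ℚ[X] := C (9 / 4) * X + 5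
  let d : ℚ[X] := 4 * X + 8
  let P : ℚ[X] := X * b * c * d * N * D * (X - b) * (X - c) * (X - d) * (b - c) * (b - d) *
    (c - d) * (X * D - N) * (b * D - N) * (c * D - N) * (d * D - N)
  have hP (t : ℚ) : P.eval t = degeneracy t := by
    have hb : b.eval t = t / 4 - 1 := by simp [b]; ring
    have hc : c.eval t = 9 * t / 4 + 5 := by simp [c]; ring
    have hd : d.eval t = 4 * t + 8 := by simp [d]
    have hN : N.eval t = fifthNum t := by simp [N, fifthNum]
    have hD : D.eval t = fifthDen t := by simp [D, fifthDen]
    simp only [P, eval_mul, eval_sub, eval_X, hb, hc, hd, hN, hD, degeneracy]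
  have hP₀ : P ≠ 0 := by
    intro h
    have h₁ := hP 1
    rw [h, eval_zero] at h₁
    norm_num [degeneracy, fifthNum, fifthDen] at h₁
  refine (Polynomial.finite_setOfPred_isRoot hP₀).subset fun t ht => ?_
  exact (hP t).trans ht

/-- To check the five-element set it is enough to check ten pairs. -/
lemma isRationalDQuintuple_of_pairs {q a b c d e : ℚ}
    (ha : a ≠ 0) (hb : b ≠ 0) (hc : c ≠ 0) (hd : d ≠ 0) (he : e ≠ 0)
    (hab : a ≠ b) (hac : a ≠ c) (had : a ≠ d) (hae : a ≠ e) (hbc : b ≠ c) (hbd : b ≠ d)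
    (hbe : b ≠ e) (hcd : c ≠ d) (hce : c ≠ e) (hde : d ≠ e)
    (sab : ∃ z, a * b + q = z ^ 2) (sac : ∃ z, a * c + q = z ^ 2)
    (sad : ∃ z, a * d + q = z ^ 2) (sae : ∃ z, a * e + q = z ^ 2)
    (sbc : ∃ z, b * c + q = z ^ 2) (sbd : ∃ z, b * d + q = z ^ 2)
    (sbe : ∃ z, b * e + q = z ^ 2) (scd : ∃ z, c * d + q = z ^ 2)
    (sce : ∃ z, c * e + q = z ^ 2) (sde : ∃ z, d * e + q = z ^ 2) :
    IsRationalDQuintuple q {a, b, c, d, e} := by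
  refine ⟨by simp [*], by simp [*], ?_⟩
  simp only [Finset.mem_insert, Finset.mem_singleton]
  rintro x (rfl | rfl | rfl | rfl | rfl) y (rfl | rfl | rfl | rfl | rfl) hxy <;>
    first
    | exact absurd rfl hxy
    | assumption
    | (rw [mul_comm]; assumption)

/-- there are infinitely many `t ∈ ℚ` such that
`{t, t/4 − 1, 9t/4 + 5, 4t + 8, (2+t)(9+4t)(8+5t)(14+5t)/(324 + 8t(62 + t(31 + 5t)))}`
is a rational `D(4t+9)`-quintuple. -/
theorem infinitely_many_D_4t_add_9_quintuples :
    {t : ℚ | IsRationalDQuintuple (4 * t + 9)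
      {t, t / 4 - 1, 9 * t / 4 + 5, 4 * t + 8,
        (2 + t) * (9 + 4 * t) * (8 + 5 * t) * (14 + 5 * t) /
          (324 + 8 * t * (62 + t * (31 + 5 * t)))}}.Infinite := by
  refine (infinite_setOf_isSquare_mul_fifthDen.sdiff finite_setOf_degeneracy_eq_zero).mono ?_
  rintro t ⟨⟨w, hw⟩, ht⟩
  have ht' : degeneracy t ≠ 0 := ht
  simp only [degeneracy, mul_ne_zero_iff, sub_ne_zero] at ht'
  obtain ⟨⟨⟨⟨⟨⟨⟨⟨⟨⟨⟨⟨⟨⟨⟨ha, hb⟩, hc⟩, hd⟩, hN⟩, hD⟩, hab⟩, hac⟩, had⟩, hbc⟩, hbd⟩, hcd⟩,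
    hae⟩, hbe⟩, hce⟩, hde⟩ := ht'
  have hfifth {x r : ℚ} (h : x * ((2 + t) * (8 + 5 * t) * (14 + 5 * t)) + fifthDen t = r ^ 2) :
      ∃ z, x * (fifthNum t / fifthDen t) + (4 * t + 9) = z ^ 2 := by
    refine ⟨r * w / fifthDen t, ?_⟩
    have hz : (r * w / fifthDen t) ^ 2 = r ^ 2 * (w * w) / fifthDen t ^ 2 := by ring
    rw [hz, ← h, ← hw, fifthNum]
    field_simp
    ring
  rw [Set.mem_ofPred_eq]
  change IsRationalDQuintuple _ {_, _, _, _, fifthNum t / fifthDen t}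
  refine isRationalDQuintuple_of_pairs ha (sub_ne_zero.2 hb) hc hd (div_ne_zero hN hD) hab hac had
    (mt (eq_div_iff hD).1 hae) hbc hbd (mt (eq_div_iff hD).1 hbe) hcd
    (mt (eq_div_iff hD).1 hce) (mt (eq_div_iff hD).1 hde)
    ⟨t / 2 + 3, by ring⟩ ⟨3 * t / 2 + 3, by ring⟩ ⟨2 * t + 3, by ring⟩
    (hfifth (r := 5 * t ^ 2 + 20 * t + 18) ?_) ⟨3 * t / 4 + 2, by ring⟩ ⟨t + 1, by ring⟩
    (hfifth (r := 5 / 2 * t ^ 2 + 11 * t + 10) ?_) ⟨3 * t + 7, by ring⟩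
    (hfifth (r := 15 / 2 * t ^ 2 + 35 * t + 38) ?_)
    (hfifth (r := 10 * t ^ 2 + 44 * t + 46) ?_) <;>
  · rw [fifthDen]
    ring
end

section
/- If s, t, u, v ∈ ℚ satisfy u² = t(2s + t) and v² = s(2t + s), then s·t = 0. Equivalently, the only rational points on the intersection of the quadric surfaces u² = t(2s+t) and v² = s(2t+s) in ℙ³ are (s : t : u : v) = (0 : 1 : ±1 : 0) and (1 : 0 : 0 : ±1). -/
theorem Int.exists_sq_of_isCoprime_of_pos {a b c : ℤ} (h : IsCoprime a b) (ha : 0 < a)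
    (heq : a * b = c ^ 2) : ∃ r, a = r ^ 2 := by
  obtain ⟨r, hr | hr⟩ := Int.sq_of_isCoprime h heq
  · exact ⟨r, hr⟩
  · nlinarith [sq_nonneg r]

/-- For coprime `x`, `w`, the integers `x² + w²` and `x² + 4w²` are coprime. -/
theorem isCoprime_sq_add_sq_sq_add_four_mul_sq {x w : ℤ} (h : IsCoprime x w) :
    IsCoprime (x ^ 2 + w ^ 2) (x ^ 2 + 4 * w ^ 2) := by
  have h₁ : IsCoprime (x ^ 2 + w ^ 2) (w ^ 2) := by
    simpa using (h.pow (m := 2) (n := 2)).add_mul_left_left 1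
  have h₂ : IsCoprime (x ^ 2 + w ^ 2) 3 := by
    refine ((Int.prime_three.coprime_iff_not_dvd).2 fun hd => ?_).symm
    have hxw : (3 : ℤ) ∣ x ∧ (3 : ℤ) ∣ w := by
      rcases (by lia : x % 3 = 0 ∨ x % 3 = 1 ∨ x % 3 = 2) with hx | hx | hx <;>
        rcases (by lia : w % 3 = 0 ∨ w % 3 = 1 ∨ w % 3 = 2) with hw | hw | hw <;>
        simp [Int.dvd_iff_emod_eq_zero, Int.add_emod, pow_two, Int.mul_emod, hx, hw] at hd ⊢
    exact Int.prime_three.not_isUnit (h.isUnit_of_dvd' hxw.1 hxw.2)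
  have h₃ := (h₂.mul_right h₁).add_mul_left_right 1
  rwa [show 3 * w ^ 2 + (x ^ 2 + w ^ 2) * 1 = x ^ 2 + 4 * w ^ 2 by ring] at h₃

/-- If `y² A = z² B` with `y`, `z` coprime and `A`, `B` coprime and positive, then `A = z²` and
`B = y²`. -/
theorem eq_sq_of_sq_mul_eq_sq_mul {y z A B : ℤ} (hyz : IsCoprime y z) (hAB : IsCoprime A B)
    (hA : 0 < A) (hB : 0 < B) (h : y ^ 2 * A = z ^ 2 * B) : A = z ^ 2 ∧ B = y ^ 2 := by
  have hyz₂ : IsCoprime (y ^ 2) (z ^ 2) := hyz.pow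
  have hAz : A ∣ z ^ 2 := hAB.dvd_of_dvd_mul_right ⟨y ^ 2, by linarith⟩
  have hzA : z ^ 2 ∣ A := hyz₂.symm.dvd_of_dvd_mul_left ⟨B, h⟩
  have hBy : B ∣ y ^ 2 := hAB.symm.dvd_of_dvd_mul_right ⟨z ^ 2, by linarith⟩
  have hyB : y ^ 2 ∣ B := hyz₂.dvd_of_dvd_mul_left ⟨A, h.symm⟩
  exact ⟨Int.dvd_antisymm hA.le (sq_nonneg z) hAz hzA,
    Int.dvd_antisymm hB.le (sq_nonneg y) hBy hyB⟩

/-- The descent step: a common leg difference `m² - n² = p² - q²` with `pq = 2mn` yields a smaller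
pair `x`, `w` with `x² + w²` and `x² + 4w²` both squares. -/
theorem exists_smaller_of_sq_sub_sq_eq {m n p q : ℤ} (hmn : IsCoprime m n) (hpq : IsCoprime p q)
    (hp : Odd p) (hq : Even q) (h : m ^ 2 - n ^ 2 = p ^ 2 - q ^ 2) (hprod : p * q = 2 * m * n)
    (h0 : 2 * m * n ≠ 0) :
    ∃ x w y z : ℤ, IsCoprime x w ∧ Odd x ∧ w ≠ 0 ∧ w.natAbs < (2 * m * n).natAbs ∧
      x ^ 2 + w ^ 2 = z ^ 2 ∧ x ^ 2 + 4 * w ^ 2 = y ^ 2 := by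
  obtain ⟨r, rfl⟩ := hq
  have hpr : p * r = m * n := by linarith
  obtain ⟨x, y, ⟨z, rfl⟩, ⟨w, rfl⟩, rfl⟩ := exists_dvd_and_dvd_of_dvd_mul (Dvd.intro r hpr)
  have hx : x ≠ 0 := by rintro rfl; simp at h0
  have hy : y ≠ 0 := by rintro rfl; simp at h0
  have hz : z ≠ 0 := by rintro rfl; simp at h0
  have hw : w ≠ 0 := by rintro rfl; simp at h0
  obtain rfl : r = z * w := by
    apply mul_left_cancel₀ (mul_ne_zero hx hy)
    linarith
  have hxw : IsCoprime x w := hmn.of_mul_left_left.of_mul_right_right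
  have hyz : IsCoprime y z :=
    hpq.of_mul_left_right.of_isCoprime_of_dvd_right ⟨w + w, by ring⟩
  obtain ⟨h₁, h₂⟩ := eq_sq_of_sq_mul_eq_sq_mul hyz (isCoprime_sq_add_sq_sq_add_four_mul_sq hxw)
    (by positivity) (by positivity) (by linarith)
  refine ⟨x, w, y, z, hxw, (Int.odd_mul.1 hp).1, hw, ?_, h₁, h₂⟩
  have hpos : 0 < (x * z * y).natAbs := by positivity
  have hwpos : 0 < w.natAbs := by positivity
  rw [show 2 * (x * z) * (y * w) = 2 * ((x * z * y) * w) by ring, Int.natAbs_mul,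
    Int.natAbs_mul (x * z * y)]
  have h2 : (2 : ℤ).natAbs = 2 := rfl
  rw [h2]
  nlinarith

/-- There are no coprime `c` odd and `a ≠ 0` with `c² + a²` and `c² + 4a²` both squares. -/
theorem not_sq_add_sq_and_sq_add_four_mul_sq {a c b d : ℤ} (hca : IsCoprime c a) (hc : Odd c)
    (ha : a ≠ 0) (h₁ : c ^ 2 + a ^ 2 = b ^ 2) (h₂ : c ^ 2 + 4 * a ^ 2 = d ^ 2) : False := by
  induction hN : a.natAbs using Nat.strong_induction_on generalizing a b c d with
  | _ N ih =>
  subst hN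
  have hc' : c % 2 = 1 := Int.odd_iff.1 hc
  have hcpos : 0 < c ^ 2 := by
    have : c ≠ 0 := by rintro rfl; simp at hc'
    positivity
  have hb : 0 < |b| := abs_pos.2 (by rintro rfl; nlinarith [sq_nonneg a])
  have hd : 0 < |d| := abs_pos.2 (by rintro rfl; nlinarith [sq_nonneg a])
  have hc2 : IsCoprime c 2 := by
    obtain ⟨k, rfl⟩ := hc
    exact ⟨1, -k, by ring⟩
  have t₁ : PythagoreanTriple c a |b| := by
    unfold PythagoreanTriple
    rw [abs_mul_abs_self]
    linarith
  have t₂ : PythagoreanTriple c (2 * a) |d| := by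
    unfold PythagoreanTriple
    rw [abs_mul_abs_self]
    linarith
  obtain ⟨m, n, hcm, ham, -, hmn, hmnp, -⟩ :=
    t₁.coprime_classification' (Int.isCoprime_iff_gcd_eq_one.1 hca) hc' hb
  obtain ⟨p, q, hcp, hap, -, hpq, hpqp, -⟩ :=
    t₂.coprime_classification' (Int.isCoprime_iff_gcd_eq_one.1 (hc2.mul_right hca)) hc' hd
  rw [← Int.isCoprime_iff_gcd_eq_one] at hmn hpq
  have hprod : p * q = 2 * m * n := by linarith
  obtain ⟨x, w, y, z, hxw, hx, hw, hlt, hz, hy⟩ : ∃ x w y z : ℤ, IsCoprime x w ∧ Odd x ∧ w ≠ 0 ∧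
      w.natAbs < a.natAbs ∧ x ^ 2 + w ^ 2 = z ^ 2 ∧ x ^ 2 + 4 * w ^ 2 = y ^ 2 := by
    rw [ham] at ha ⊢
    rcases hpqp with ⟨hp, hq⟩ | ⟨hp, hq⟩
    · rw [show 2 * m * n = 2 * n * m by ring] at ha ⊢
      exact exists_smaller_of_sq_sub_sq_eq hmn.symm hpq.symm (Int.odd_iff.2 hq)
        (Int.even_iff.2 hp) (by linarith) (by linarith) ha
    · exact exists_smaller_of_sq_sub_sq_eq hmn hpq (Int.odd_iff.2 hp)
        (Int.even_iff.2 hq) (by linarith) hprod ha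
  exact ih _ hlt hxw hx hw hz hy rfl

theorem not_mul_eq_sq_and_mul_eq_sq_of_even {n d u v : ℤ} (hn : 0 < n) (hd : 0 < d)
    (hnd : IsCoprime n d) (hodd : Odd n) (heven : Even d) (hu : d * (2 * n + d) = u ^ 2)
    (hv : n * (2 * d + n) = v ^ 2) : False := by
  obtain ⟨e, rfl⟩ := heven
  have hne : IsCoprime n e := hnd.of_isCoprime_of_dvd_right ⟨2, by ring⟩
  have hue : Even u := by
    rw [← Int.even_pow' two_ne_zero, ← hu]
    exact (Even.add_self e).mul_right _
  obtain ⟨u, rfl⟩ := hue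
  have he : 0 < e := by linarith
  have hen : IsCoprime e (n + e) := by simpa using hne.symm.add_mul_left_right 1
  have hu' : e * (n + e) = u ^ 2 := by linarith
  obtain ⟨a, ha⟩ := Int.exists_sq_of_isCoprime_of_pos hen he hu'
  obtain ⟨b, hb⟩ := Int.exists_sq_of_isCoprime_of_pos hen.symm (by linarith)
    ((mul_comm _ _).trans hu')
  have hn4 : IsCoprime n (2 * (e + e) + n) := by
    have h2 : IsCoprime n 2 := by
      obtain ⟨k, rfl⟩ := hodd
      exact ⟨1, -k, by ring⟩
    have h := (h2.mul_right hnd).add_mul_left_right 1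
    rwa [mul_one] at h
  obtain ⟨c, hc⟩ := Int.exists_sq_of_isCoprime_of_pos hn4 hn hv
  obtain ⟨f, hf⟩ := Int.exists_sq_of_isCoprime_of_pos hn4.symm (by linarith)
    ((mul_comm _ _).trans hv)
  rw [hc, ha, IsCoprime.pow_iff two_pos two_pos] at hne
  rw [hc, Int.odd_pow' two_ne_zero] at hodd
  exact not_sq_add_sq_and_sq_add_four_mul_sq hne hodd (by rintro rfl; simp [ha] at he)
    (by linarith : c ^ 2 + a ^ 2 = b ^ 2) (by linarith : c ^ 2 + 4 * a ^ 2 = f ^ 2)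

theorem not_mul_eq_sq_and_mul_eq_sq_of_isCoprime {n d u v : ℤ} (hn : 0 < n) (hd : 0 < d)
    (hnd : IsCoprime n d) (hu : d * (2 * n + d) = u ^ 2) (hv : n * (2 * d + n) = v ^ 2) :
    False := by
  rcases Int.even_or_odd n with hn₂ | hn₂ <;> rcases Int.even_or_odd d with hd₂ | hd₂
  · exact Int.prime_two.not_isUnit (hnd.isUnit_of_dvd' hn₂.two_dvd hd₂.two_dvd)
  · exact not_mul_eq_sq_and_mul_eq_sq_of_even hd hn hnd.symm hd₂ hn₂ hv hu
  · exact not_mul_eq_sq_and_mul_eq_sq_of_even hn hd hnd hn₂ hd₂ hu hv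
  · obtain ⟨k, rfl⟩ := hn₂
    obtain ⟨l, rfl⟩ := hd₂
    rcases Int.even_or_odd' u with ⟨j, rfl | rfl⟩ <;> ring_nf at hu <;> lia

/-- if `s, t, u, v ∈ ℚ` satisfy `u² = t(2s + t)` and `v² = s(2t + s)`, then
`s·t = 0` (so the only projective rational points on this intersection of quadrics are
`(0 : 1 : ±1 : 0)` and `(1 : 0 : 0 : ±1)`). -/
theorem quadric_intersection_one :
    ∀ s t u v : ℚ, u ^ 2 = t * (2 * s + t) → v ^ 2 = s * (2 * t + s) → s * t = 0 := by
  intro s t u v hu hv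
  by_contra hst
  obtain ⟨hs, ht⟩ := mul_ne_zero_iff.1 hst
  obtain ⟨r, rfl⟩ : ∃ r, s = r * t := ⟨s / t, by field_simp⟩
  have hr : r ≠ 0 := left_ne_zero_of_mul hs
  have hnum : (r.num : ℚ) = r * r.den := (Rat.mul_den_eq_num r).symm
  have hU : IsSquare ((r.den : ℤ) * (2 * r.num + r.den)) := by
    rw [← Rat.isSquare_intCast_iff]
    refine ⟨u / t * r.den, ?_⟩
    push_cast
    rw [hnum]
    field_simp
    linear_combination -hu
  have hV : IsSquare (r.num * (2 * (r.den : ℤ) + r.num)) := by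
    rw [← Rat.isSquare_intCast_iff]
    refine ⟨v / t * r.den, ?_⟩
    push_cast
    rw [hnum]
    field_simp
    linear_combination -hv
  obtain ⟨U, hU⟩ := hU
  obtain ⟨V, hV⟩ := hV
  have hd : (0 : ℤ) < r.den := by exact_mod_cast r.den_pos
  have hn : 0 < r.num := by
    have h₁ : 0 ≤ 2 * r.num + r.den :=
      nonneg_of_mul_nonneg_right (hU ▸ mul_self_nonneg U) hd
    have h₂ : 0 ≤ r.num :=
      nonneg_of_mul_nonneg_left (hV ▸ mul_self_nonneg V) (by linarith)
    exact h₂.lt_of_ne' (Rat.num_ne_zero.2 hr)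
  exact not_mul_eq_sq_and_mul_eq_sq_of_isCoprime hn hd r.isCoprime_num_den
    (hU.trans (sq U).symm) (hV.trans (sq V).symm)
end

section
/- If s, t, u, v ∈ ℚ satisfy u² = −s(s + 2t) and v² = t² − s², then s·(s + t) = 0. Equivalently, the only rational points on the intersection of the quadric surfaces u² = −s(s+2t) and v² = −s² + t² in ℙ³ are (s : t : u : v) = (0 : 1 : 0 : ±1) and (1 : −1 : ±1 : 0). -/
theorem sq_add_sq_eq_sq_of_sq_mul_eq {x y z w : ℤ} (hxw : IsCoprime x w) (hyz : IsCoprime y z)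
    (hz : z ≠ 0) (h : z ^ 2 * (4 * x ^ 2 + w ^ 2) = y ^ 2 * (x ^ 2 + w ^ 2)) :
    x ^ 2 + w ^ 2 = z ^ 2 ∧ 4 * x ^ 2 + w ^ 2 = y ^ 2 := by
  obtain ⟨k, hk⟩ : z ^ 2 ∣ x ^ 2 + w ^ 2 :=
    (hyz.symm.pow (m := 2) (n := 2)).dvd_of_dvd_mul_left ⟨_, h.symm⟩
  have hz2 : 0 < z ^ 2 := by positivity
  have hk' : 4 * x ^ 2 + w ^ 2 = y ^ 2 * k := by
    apply mul_left_cancel₀ hz2.ne'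
    rw [h, hk]
    ring
  have hpos : 0 < x ^ 2 + w ^ 2 := by
    rcases eq_or_ne x 0 with rfl | hx
    · have : w ≠ 0 := (isCoprime_zero_left.1 hxw).ne_zero
      positivity
    · positivity
  have hk0 : 0 < k := pos_of_mul_pos_right (hk ▸ hpos) hz2.le
  have hk3 : k ∣ 3 := by
    obtain ⟨p, q, hpq⟩ := hxw.pow (m := 2) (n := 2)
    refine ⟨p * (y ^ 2 - z ^ 2) + q * (4 * z ^ 2 - y ^ 2), ?_⟩
    linear_combination -3 * hpq + (4 * q - p) * hk + (p - q) * hk'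
  have hle : k ≤ 3 := Int.le_of_dvd (by norm_num) hk3
  interval_cases k
  · exact ⟨by linarith, by linarith⟩
  · norm_num at hk3
  · exfalso
    have h3 : (x ^ 2 + w ^ 2) % 3 = 0 := by omega
    have hx3 : (3 : ℤ) ∣ x ∧ (3 : ℤ) ∣ w := by
      rcases (by omega : x % 3 = 0 ∨ x % 3 = 1 ∨ x % 3 = 2) with hx | hx | hx <;>
      rcases (by omega : w % 3 = 0 ∨ w % 3 = 1 ∨ w % 3 = 2) with hw | hw | hw <;>
      (simp [pow_two, Int.add_emod, Int.mul_emod, hx, hw] at h3 ⊢; try omega)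
    have := hxw.isUnit_of_dvd' hx3.1 hx3.2
    norm_num [Int.isUnit_iff] at this

/-- The descent step: an odd solution of `a² + c² = □`, `4a² + c² = □` comes from a smaller one. -/
theorem exists_smaller_of_odd {a b c d : ℤ} (ha : a ≠ 0) (hac : IsCoprime a c)
    (hodd : c % 2 = 1) (hb : a ^ 2 + c ^ 2 = b ^ 2) (hd : 4 * a ^ 2 + c ^ 2 = d ^ 2) :
    ∃ x w y z : ℤ, x ≠ 0 ∧ w ≠ 0 ∧ IsCoprime x w ∧ x ^ 2 + w ^ 2 = z ^ 2 ∧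
      4 * x ^ 2 + w ^ 2 = y ^ 2 ∧ 2 * (x * w) ∣ a := by
  have hb0 : 0 < |b| := by
    rw [abs_pos]
    rintro rfl
    have : 0 < a ^ 2 := by positivity
    nlinarith [sq_nonneg c]
  have hd0 : 0 < |d| := by
    rw [abs_pos]
    rintro rfl
    have : 0 < a ^ 2 := by positivity
    nlinarith [sq_nonneg c]
  have h2c : IsCoprime 2 c := ⟨-(c / 2), 1, by omega⟩
  obtain ⟨m, n, hc1, ha1, -, hmn, -, -⟩ := PythagoreanTriple.coprime_classification'
    (x := c) (y := a) (z := |b|)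
    (by unfold PythagoreanTriple; rw [abs_mul_abs_self]; linarith)
    (Int.isCoprime_iff_gcd_eq_one.1 hac.symm) hodd hb0
  obtain ⟨r, s, hc2, ha2, -, hrs, hpar, -⟩ := PythagoreanTriple.coprime_classification'
    (x := c) (y := 2 * a) (z := |d|)
    (by unfold PythagoreanTriple; rw [abs_mul_abs_self]; linarith)
    (Int.isCoprime_iff_gcd_eq_one.1 (h2c.mul_left hac).symm) hodd hd0
  rw [← Int.isCoprime_iff_gcd_eq_one] at hmn hrs
  have hrsmn : r * s = 2 * (m * n) := by linarith
  have hmn0 : m * n ≠ 0 := fun h => ha (by rw [ha1, mul_assoc, h, mul_zero])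
  have hm0 := left_ne_zero_of_mul hmn0
  have hn0 := right_ne_zero_of_mul hmn0
  rcases hpar with ⟨hr, -⟩ | ⟨-, hs⟩
  · obtain ⟨r, rfl⟩ := Int.dvd_of_emod_eq_zero hr
    have hprod : m * n = r * s := by linarith
    obtain ⟨x, z, ⟨y, rfl⟩, ⟨w, rfl⟩, rfl⟩ := exists_dvd_and_dvd_of_dvd_mul ⟨s, hprod⟩
    have hx0 := left_ne_zero_of_mul hm0
    have hz0 := left_ne_zero_of_mul hn0
    have hw0 := right_ne_zero_of_mul hn0
    obtain rfl : s = y * w := by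
      apply mul_left_cancel₀ (mul_ne_zero hx0 hz0)
      linarith
    have hxw : IsCoprime x w :=
      (hrs.of_isCoprime_of_dvd_left ⟨2 * z, by ring⟩).of_isCoprime_of_dvd_right ⟨y, by ring⟩
    have hyz : IsCoprime y z :=
      (hmn.of_isCoprime_of_dvd_left ⟨x, by ring⟩).of_isCoprime_of_dvd_right ⟨w, by ring⟩
    obtain ⟨h1, h2⟩ := sq_add_sq_eq_sq_of_sq_mul_eq hxw hyz hz0
      (by linear_combination hc1 - hc2)
    exact ⟨x, w, y, z, hx0, hw0, hxw, h1, h2, y * z, by rw [ha1]; ring⟩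
  · obtain ⟨s, rfl⟩ := Int.dvd_of_emod_eq_zero hs
    have hprod : m * n = r * s := by linarith
    obtain ⟨x, z, ⟨y, rfl⟩, ⟨w, rfl⟩, rfl⟩ := exists_dvd_and_dvd_of_dvd_mul ⟨s, hprod⟩
    have hx0 := left_ne_zero_of_mul hm0
    have hy0 := right_ne_zero_of_mul hm0
    have hz0 := left_ne_zero_of_mul hn0
    have hw0 := right_ne_zero_of_mul hn0
    obtain rfl : s = y * w := by
      apply mul_left_cancel₀ (mul_ne_zero hx0 hz0)
      linarith
    have hxw : IsCoprime x w :=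
      (hrs.of_isCoprime_of_dvd_left ⟨z, by ring⟩).of_isCoprime_of_dvd_right ⟨2 * y, by ring⟩
    have hyz : IsCoprime y z :=
      (hmn.of_isCoprime_of_dvd_left ⟨x, by ring⟩).of_isCoprime_of_dvd_right ⟨w, by ring⟩
    obtain ⟨h1, h2⟩ := sq_add_sq_eq_sq_of_sq_mul_eq hxw.symm hyz.symm hy0
      (by linear_combination hc2 - hc1)
    exact ⟨w, x, z, y, hw0, hx0, hxw.symm, h1, h2, y * z, by rw [ha1]; ring⟩

theorem not_sq_add_sq_and_four_mul_sq_add_sq (N : ℕ) : ∀ {a b c d : ℤ}, (a * c).natAbs = N →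
    a ≠ 0 → c ≠ 0 → IsCoprime a c → a ^ 2 + c ^ 2 = b ^ 2 → 4 * a ^ 2 + c ^ 2 = d ^ 2 →
    False := by
  induction N using Nat.strong_induction_on with
  | _ N ih =>
  intro a b c d hN ha hc hac hb hd
  rcases Int.emod_two_eq_zero_or_one c with hpar | hpar
  · obtain ⟨e, rfl⟩ := Int.dvd_of_emod_eq_zero hpar
    have he : e ≠ 0 := right_ne_zero_of_mul hc
    obtain ⟨f, rfl⟩ : (2 : ℤ) ∣ d := by
      apply Int.prime_two.dvd_of_dvd_pow (n := 2)
      exact ⟨2 * a ^ 2 + 2 * e ^ 2, by linarith⟩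
    have hea : IsCoprime e a := (hac.of_isCoprime_of_dvd_right ⟨2, by ring⟩).symm
    refine ih _ ?_ rfl he ha hea (b := f) (d := b) (by linarith) (by linarith)
    have : 0 < (e * a).natAbs := Int.natAbs_pos.2 (mul_ne_zero he ha)
    have h2 : a * (2 * e) = 2 * (e * a) := by ring
    omega
  · obtain ⟨x, w, y, z, hx, hw, hxw, h1, h2, k, hk⟩ := exists_smaller_of_odd ha hac hpar hb hd
    refine ih _ ?_ rfl hx hw hxw h1 h2
    have h0 : 0 < (x * w).natAbs := Int.natAbs_pos.2 (mul_ne_zero hx hw)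
    have hkc : k * c ≠ 0 := by
      apply mul_ne_zero _ hc
      rintro rfl
      simp [hk] at ha
    have h1 : 0 < (k * c).natAbs := Int.natAbs_pos.2 hkc
    have h2 : a * c = 2 * ((x * w) * (k * c)) := by rw [hk]; ring
    rw [← hN, h2, Int.natAbs_mul 2, Int.natAbs_mul (x * w)]
    change _ < 2 * _
    nlinarith

theorem not_sq_sub_sq_and_mul_of_even {p q u v : ℤ} (hp : 0 < p) (hpq : p < q)
    (hco : IsCoprime p q) (hpar : p % 2 = 0) (hu : p * (2 * q - p) = u ^ 2)
    (hv : q ^ 2 - p ^ 2 = v ^ 2) : False := by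
  obtain ⟨e, rfl⟩ := Int.dvd_of_emod_eq_zero hpar
  obtain ⟨f, rfl⟩ : (2 : ℤ) ∣ u :=
    Int.prime_two.dvd_of_dvd_pow (n := 2) ⟨e * (2 * q - 2 * e), by linarith⟩
  have heq : IsCoprime e q := hco.of_isCoprime_of_dvd_left ⟨2, by ring⟩
  have h2q : IsCoprime 2 q := hco.of_isCoprime_of_dvd_left ⟨e, by ring⟩
  have h1 : IsCoprime e (q - e) := by
    obtain ⟨i, j, h⟩ := heq
    exact ⟨i + j, j, by linear_combination h⟩
  have h2 : IsCoprime (q - 2 * e) (q + 2 * e) := by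
    have h3 : IsCoprime (2 * (2 * e)) (q - 2 * e) := by
      refine IsCoprime.mul_left ?_ ?_
      · obtain ⟨i, j, h⟩ := h2q
        exact ⟨i + j * e, j, by linear_combination h⟩
      · obtain ⟨i, j, h⟩ := hco
        exact ⟨i + j, j, by linear_combination h⟩
    obtain ⟨i, j, h⟩ := h3
    exact ⟨j - i, i, by linear_combination h⟩
  obtain ⟨c, hc⟩ := Int.sq_of_isCoprime h1 (c := f) (by linarith)
  obtain ⟨d, hd⟩ := Int.sq_of_isCoprime h1.symm (c := f) (by linarith)
  obtain ⟨a, ha⟩ := Int.sq_of_isCoprime h2 (c := v) (by linarith)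
  obtain ⟨b, hb⟩ := Int.sq_of_isCoprime h2.symm (c := v) (by linarith)
  replace hc : e = c ^ 2 := hc.resolve_right (by nlinarith [sq_nonneg c])
  replace hd : q - e = d ^ 2 := hd.resolve_right (by nlinarith [sq_nonneg d])
  replace ha : q - 2 * e = a ^ 2 := ha.resolve_right (by nlinarith [sq_nonneg a])
  replace hb : q + 2 * e = b ^ 2 := hb.resolve_right (by nlinarith [sq_nonneg b])
  have hc0 : c ≠ 0 := by
    rintro rfl
    norm_num at hc
    omega
  have ha0 : a ≠ 0 := by
    rintro rfl
    norm_num at ha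
    omega
  refine not_sq_add_sq_and_four_mul_sq_add_sq _ rfl hc0 ha0 ?_
    (b := d) (d := b) (by linarith) (by linarith)
  rw [← IsCoprime.pow_iff two_pos two_pos, ← hc, ← ha]
  obtain ⟨i, j, h⟩ := heq
  exact ⟨i + 2 * j, j, by linear_combination h⟩

theorem not_sq_sub_sq_and_mul {p q u v : ℤ} (hp : 0 < p) (hpq : p < q)
    (hco : IsCoprime p q) (hu : p * (2 * q - p) = u ^ 2) (hv : q ^ 2 - p ^ 2 = v ^ 2) :
    False := by
  rcases Int.emod_two_eq_zero_or_one p with hp2 | hp2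
  · exact not_sq_sub_sq_and_mul_of_even hp hpq hco hp2 hu hv
  rcases Int.emod_two_eq_zero_or_one q with hq2 | hq2
  · obtain ⟨j, rfl⟩ := Int.dvd_of_emod_eq_zero hq2
    have hp4 := Int.sq_mod_four_eq_one_of_odd (Int.odd_iff.2 hp2)
    rcases Int.even_or_odd v with ⟨i, rfl⟩ | hvo
    · ring_nf at hv hp4
      omega
    · have hv4 := Int.sq_mod_four_eq_one_of_odd hvo
      ring_nf at hv hp4 hv4
      omega
  · refine not_sq_sub_sq_and_mul_of_even (p := q - p) (q := q) (u := v) (v := u) (by omega)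
      (by omega) ?_ (by omega) (by linarith) (by linarith)
    obtain ⟨i, j, h⟩ := hco
    exact ⟨-i, i + j, by linear_combination h⟩

/-- if `s, t, u, v ∈ ℚ` satisfy `u² = −s(s + 2t)` and `v² = t² − s²`, then
`s·(s + t) = 0` (so the only projective rational points on this intersection of quadrics are
`(0 : 1 : 0 : ±1)` and `(1 : −1 : ±1 : 0)`). -/
theorem quadric_intersection_two :
    ∀ s t u v : ℚ, u ^ 2 = -s * (s + 2 * t) → v ^ 2 = t ^ 2 - s ^ 2 → s * (s + t) = 0 := by
  intro s t u v hu hv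
  rcases eq_or_ne t 0 with rfl | ht
  · have : s = 0 := by
      rw [← sq_eq_zero_iff]
      nlinarith [sq_nonneg v, sq_nonneg s]
    simp [this]
  obtain ⟨x, rfl⟩ : ∃ x, s = -(x * t) := ⟨-s / t, by field_simp⟩
  have hq : (x.den : ℚ) ≠ 0 := by exact_mod_cast x.den_ne_zero
  have hx : x * x.den = x.num := Rat.mul_den_eq_num x
  have hsqu : IsSquare (x.num * (2 * x.den - x.num) : ℤ) := by
    rw [← Rat.isSquare_intCast_iff]
    refine ⟨u * x.den / t, ?_⟩
    push_cast
    rw [← hx]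
    field_simp
    linear_combination -hu
  have hsqv : IsSquare ((x.den : ℤ) ^ 2 - x.num ^ 2) := by
    rw [← Rat.isSquare_intCast_iff]
    refine ⟨v * x.den / t, ?_⟩
    push_cast
    rw [← hx]
    field_simp
    linear_combination -hv
  obtain ⟨U, hU⟩ := hsqu
  obtain ⟨V, hV⟩ := hsqv
  have hden : (0 : ℤ) < x.den := by exact_mod_cast x.den_pos
  have hle : x.num ≤ x.den := by nlinarith [mul_self_nonneg V]
  have hnonneg : 0 ≤ x.num := by nlinarith [mul_self_nonneg U]
  rcases hnonneg.eq_or_lt with h0 | h0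
  · simp [Rat.num_eq_zero.1 h0.symm]
  rcases hle.eq_or_lt with h1 | h1
  · have : x = 1 := by
      apply mul_right_cancel₀ hq
      rw [hx, h1]
      simp
    simp [this]
  · exact (not_sq_sub_sq_and_mul h0 h1 (Rat.isCoprime_num_den x)
      (hU.trans (sq U).symm) (hV.trans (sq V).symm)).elim
end

section
/- Let s, t ∈ ℚ with s·t ≠ 0, s ≠ t, s + t ≠ 0, t + 2s ≠ 0, and s + 2t ≠ 0. Set k₁ = (t² + s² + ts)/(t + s), k₂ = −ts/(t + s), k₃ = t, k₄ = s (these are pairwise distinct nonzero rationals). Then the group E(ℚ) of rational points of the corresponding Jacobian curve E contains no point of order 4; that is, the genus-one curve v² = (k₁u+1)(k₂u+1)(k₃u+1)(k₄u+1) has no rational 4-torsion point for any such choice of s and t. -/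
theorem Int.exists_sq_and_sq_of_mul_eq_sq {X Y c : ℤ} (hX : 0 ≤ X) (hY : 0 ≤ Y)
    (hXY : IsCoprime X Y) (h : X * Y = c ^ 2) :
    ∃ m n : ℤ, X = m ^ 2 ∧ Y = n ^ 2 ∧ m * n = c := by
  obtain ⟨m, hm⟩ := Int.sq_of_gcd_eq_one (Int.isCoprime_iff_gcd_eq_one.1 hXY) h
  obtain ⟨n, hn⟩ := Int.sq_of_gcd_eq_one (Int.isCoprime_iff_gcd_eq_one.1 hXY.symm)
    ((mul_comm _ _).trans h)
  have hm' : X = m ^ 2 := by rcases hm with hm | hm <;> nlinarith [sq_nonneg m]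
  have hn' : Y = n ^ 2 := by rcases hn with hn | hn <;> nlinarith [sq_nonneg n]
  have hprod : (m * n) ^ 2 = c ^ 2 := by rw [mul_pow, ← hm', ← hn', h]
  rcases sq_eq_sq_iff_eq_or_eq_neg.1 hprod with h | h
  · exact ⟨m, n, hm', hn', h⟩
  · exact ⟨-m, n, by rw [neg_sq, hm'], hn', by rw [neg_mul, h, neg_neg]⟩

theorem exists_parametrization_of_sq_sub_sq {p q a : ℤ} (hpq : IsCoprime p q) (hq : Even q)
    (hp : 0 < p) (ha : a ^ 2 = p ^ 2 - q ^ 2) :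
    ∃ u v : ℤ, p = u ^ 2 + v ^ 2 ∧ q = 2 * (u * v) ∧ IsCoprime u v := by
  obtain ⟨c, hc⟩ := hq
  have hpar : Even (p - a) := by
    have h : Even (a ^ 2 - p ^ 2) := ⟨-2 * c ^ 2, by rw [ha, hc]; ring⟩
    simpa [Int.even_sub, Int.even_pow, iff_comm] using h
  obtain ⟨A, hA⟩ := hpar
  obtain ⟨B, hB⟩ : ∃ B, B = p - A := ⟨_, rfl⟩
  have hAB : A * B = c ^ 2 := by
    have ha' : a = p - 2 * A := by linarith
    subst ha' hB hc
    linarith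
  have hsum : A + B = p := by linarith
  have hpc : IsCoprime p c := hpq.of_isCoprime_of_dvd_right ⟨2, by rw [hc]; ring⟩
  have hcop : IsCoprime A B := by
    have h : IsCoprime A (A + B) := by
      rw [hsum]
      exact (IsCoprime.pow_right (n := 2) hpc).symm.of_isCoprime_of_dvd_left ⟨B, hAB.symm⟩
    have h' := h.add_mul_left_right (-1)
    simpa using h'
  have hA0 : 0 ≤ A := by
    by_contra hneg
    nlinarith [sq_nonneg c, mul_pos_of_neg_of_neg (not_le.1 hneg) (not_le.1 hneg)]
  have hB0 : 0 ≤ B := by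
    by_contra hneg
    nlinarith [sq_nonneg c, mul_pos_of_neg_of_neg (not_le.1 hneg) (not_le.1 hneg)]
  obtain ⟨u, v, hu, hv, huv⟩ := Int.exists_sq_and_sq_of_mul_eq_sq hA0 hB0 hcop hAB
  rw [hu, hv] at hcop
  exact ⟨u, v, by rw [← hu, ← hv, hsum], by rw [huv, hc]; ring,
    (IsCoprime.pow_iff two_pos two_pos).1 hcop⟩

theorem exists_parametrization_of_sq_add_three_mul_sq {p c b : ℤ} (hpc : IsCoprime p c)
    (h3 : ¬ (3 : ℤ) ∣ p) (hp : 0 < p) (hp4 : p % 4 = 1) (hb : b ^ 2 = p ^ 2 + 3 * (2 * c) ^ 2) :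
    ∃ m n : ℤ, p = m ^ 2 - 3 * n ^ 2 ∧ m * n = c := by
  wlog hb0 : 0 ≤ b generalizing b
  · exact this (b := -b) (by rw [neg_sq, hb]) (by linarith)
  have hpb : p ≤ b := by nlinarith [sq_nonneg c]
  have hpar : Even (b - p) := by
    have h : Even (b ^ 2 - p ^ 2) := ⟨6 * c ^ 2, by rw [hb]; ring⟩
    simpa [Int.even_sub, Int.even_pow] using h
  obtain ⟨C, hC⟩ := hpar
  obtain ⟨D, hD⟩ : ∃ D, D = p + C := ⟨_, rfl⟩
  have hCD : C * D = 3 * c ^ 2 := by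
    have hb' : b = p + 2 * C := by linarith
    subst hb' hD
    linarith
  have hC0 : 0 ≤ C := by linarith
  have hD0 : 0 < D := by linarith
  have h3p : IsCoprime (3 : ℤ) p := (Int.prime_three.coprime_iff_not_dvd).2 h3
  have hcop : IsCoprime C D := by
    have h : IsCoprime C p :=
      (h3p.mul_left (IsCoprime.pow_left (m := 2) hpc.symm)).of_isCoprime_of_dvd_left ⟨D, hCD.symm⟩
    have h' := h.add_mul_left_right 1
    simpa [hD] using h'
  rcases Int.prime_three.dvd_or_dvd ⟨c ^ 2, hCD⟩ with ⟨E, hE⟩ | ⟨E, hE⟩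
  · obtain ⟨m, n, hm, hn, hmn⟩ := Int.exists_sq_and_sq_of_mul_eq_sq (c := c) hD0.le (by linarith)
      (hcop.symm.of_isCoprime_of_dvd_right ⟨3, by rw [hE]; ring⟩) (by subst hE; linarith)
    exact ⟨m, n, by linarith, hmn⟩
  · obtain ⟨m, n, hm, hn, hmn⟩ := Int.exists_sq_and_sq_of_mul_eq_sq (c := c) hC0 (Y := E) (by linarith)
      (hcop.of_isCoprime_of_dvd_right ⟨3, by rw [hE]; ring⟩) (by rw [hE] at hCD; linarith)
    exfalso
    have hp' : p = 3 * n ^ 2 - m ^ 2 := by linarith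
    rcases Int.even_or_odd m with ⟨i, hi⟩ | ⟨i, hi⟩ <;>
      rcases Int.even_or_odd n with ⟨j, hj⟩ | ⟨j, hj⟩ <;>
      subst hi hj <;> ring_nf at hp' <;> omega

/-- The descent step for the equations `a ^ 2 = p ^ 2 - q ^ 2` and `b ^ 2 = p ^ 2 + 3 * q ^ 2`. -/
theorem exists_smaller_of_sq_system {p q a b : ℤ} (hpq : IsCoprime p q) (hq : Even q)
    (hq0 : q ≠ 0) (ha : a ^ 2 = p ^ 2 - q ^ 2) (hb : b ^ 2 = p ^ 2 + 3 * q ^ 2) :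
    ∃ y z : ℤ, IsCoprime z y ∧ y ≠ 0 ∧ 0 < (z ^ 2 - y ^ 2) ∧ (y * z) ^ 2 < q ^ 2 ∧
      IsSquare ((z ^ 2 - y ^ 2) * (z ^ 2 + 3 * y ^ 2)) := by
  wlog hp : 0 < p generalizing p
  · refine this (p := -p) hpq.neg_left (by rw [neg_sq, ha]) (by rw [neg_sq, hb]) ?_
    have : p ≠ 0 := by
      rintro rfl
      have := sq_nonneg a
      have := sq_pos_of_ne_zero hq0
      linarith
    rcases lt_trichotomy p 0 with h | h | h <;> grind
  obtain ⟨u, v, hpuv, hquv, huv⟩ := exists_parametrization_of_sq_sub_sq hpq hq hp ha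
  have hpc : IsCoprime p (u * v) := hpq.of_isCoprime_of_dvd_right ⟨2, by rw [hquv]; ring⟩
  have hp2 : p % 2 = 1 := by
    have h := hpq.of_isCoprime_of_dvd_right hq.two_dvd
    have := (Int.prime_two.coprime_iff_not_dvd).1 h.symm
    omega
  have hp4 : p % 4 = 1 := by
    rcases Int.even_or_odd u with ⟨i, hi⟩ | ⟨i, hi⟩ <;>
      rcases Int.even_or_odd v with ⟨j, hj⟩ | ⟨j, hj⟩ <;>
      rw [hi, hj] at hpuv <;> ring_nf at hpuv <;> omega
  have h3 : ¬ (3 : ℤ) ∣ p := by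
    rintro ⟨k, hk⟩
    have hb3 : (3 : ℤ) ∣ b := Int.prime_three.dvd_of_dvd_pow (n := 2)
      ⟨3 * k ^ 2 + q ^ 2, by rw [hb, hk]; ring⟩
    obtain ⟨l, rfl⟩ := hb3
    have hq3 : (3 : ℤ) ∣ q := Int.prime_three.dvd_of_dvd_pow (n := 2)
      ⟨l ^ 2 - k ^ 2, by rw [hk] at hb; linarith⟩
    have := hpq.isUnit_of_dvd' ⟨k, hk⟩ hq3
    exact Int.prime_three.not_isUnit this
  obtain ⟨m, n, hpmn, hmn⟩ :=
    exists_parametrization_of_sq_add_three_mul_sq hpc h3 hp hp4 (by rw [hb, hquv])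
  obtain ⟨x, z, ⟨y, rfl⟩, ⟨w, rfl⟩, rfl⟩ := exists_dvd_and_dvd_of_dvd_mul (Dvd.intro n hmn)
  subst hquv
  have hx : x ≠ 0 := by rintro rfl; simp at hq0
  have hy : y ≠ 0 := by rintro rfl; simp at hq0
  have hz : z ≠ 0 := by rintro rfl; simp at hq0
  have hw : w ≠ 0 := by rintro rfl; simp at hq0
  have hn : n = y * w := by
    apply mul_left_cancel₀ (mul_ne_zero hx hz)
    rw [hmn]; ring
  subst hn
  have hrel : x ^ 2 * (z ^ 2 - y ^ 2) = w ^ 2 * (z ^ 2 + 3 * y ^ 2) := by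
    rw [hpuv] at hpmn; linarith
  have hx2 := sq_pos_of_ne_zero hx
  have hy2 := sq_pos_of_ne_zero hy
  have hz2 := sq_pos_of_ne_zero hz
  have hw2 := sq_pos_of_ne_zero hw
  refine ⟨y, z, ?_, hy, ?_, ?_, ?_⟩
  · exact (huv.symm.of_isCoprime_of_dvd_left ⟨w, rfl⟩).of_isCoprime_of_dvd_right ⟨x, mul_comm _ _⟩
  · refine pos_of_mul_pos_right (a := x ^ 2) ?_ hx2.le
    rw [hrel]; positivity
  · have h1 : 1 ≤ (x * w) ^ 2 := by
      have : 0 < (x * w) ^ 2 := by positivity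
      omega
    have h2 : 0 < (y * z) ^ 2 := by positivity
    have h3 : (2 * (x * y * (z * w))) ^ 2 = 4 * ((x * w) ^ 2 * (y * z) ^ 2) := by ring
    rw [h3]
    nlinarith
  · have h : ((w * (z ^ 2 + 3 * y ^ 2)) ^ 2) =
        x ^ 2 * ((z ^ 2 - y ^ 2) * (z ^ 2 + 3 * y ^ 2)) := by
      linear_combination -(z ^ 2 + 3 * y ^ 2) * hrel
    obtain ⟨r, hr⟩ : x ∣ w * (z ^ 2 + 3 * y ^ 2) :=
      (Int.pow_dvd_pow_iff two_ne_zero).1 ⟨_, h⟩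
    refine ⟨r, mul_left_cancel₀ hx2.ne' ?_⟩
    rw [← h, hr]; ring

theorem exists_sq_system_of_isSquare {z y : ℤ} (hzy : IsCoprime z y) (hy : y ≠ 0)
    (hpos : 0 < z ^ 2 - y ^ 2) (hsq : IsSquare ((z ^ 2 - y ^ 2) * (z ^ 2 + 3 * y ^ 2))) :
    ∃ p q a b : ℤ, IsCoprime p q ∧ Even q ∧ q ≠ 0 ∧ a ^ 2 = p ^ 2 - q ^ 2 ∧
      b ^ 2 = p ^ 2 + 3 * q ^ 2 ∧ q ^ 2 ≤ (y * z) ^ 2 := by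
  obtain ⟨r, hr⟩ := hsq
  have hy2 := sq_pos_of_ne_zero hy
  have hcop : IsCoprime (z ^ 2 - y ^ 2) (y ^ 2) := by
    simpa [sub_eq_add_neg] using (hzy.pow (m := 2) (n := 2)).add_mul_right_left (-1)
  rcases Int.even_or_odd (z ^ 2 - y ^ 2) with heven | hodd
  · have hzodd : Odd z ∧ Odd y := by
      have h2 : ¬ (2 : ℤ) ∣ y := fun h ↦ Int.prime_two.not_isUnit
        (hcop.isUnit_of_dvd' heven.two_dvd (dvd_pow h two_ne_zero))
      have hyo : Odd y := by
        rw [← Int.not_even_iff_odd, even_iff_two_dvd]; exact h2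
      refine ⟨?_, hyo⟩
      by_contra hz
      rw [Int.not_odd_iff_even] at hz
      exact Int.not_even_iff_odd.2 hyo (by simpa [Int.even_sub, Int.even_pow, hz] using heven)
    obtain ⟨⟨i, hi⟩, ⟨j, hj⟩⟩ := hzodd
    obtain ⟨X, hX⟩ : ∃ X, X = i ^ 2 + i - j ^ 2 - j := ⟨_, rfl⟩
    have hX4 : z ^ 2 - y ^ 2 = 4 * X := by subst hi hj hX; ring
    have hY4 : z ^ 2 + 3 * y ^ 2 = 4 * (X + y ^ 2) := by linarith
    have hX0 : 0 < X := by linarith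
    obtain ⟨c, rfl⟩ : (4 : ℤ) ∣ r := (Int.pow_dvd_pow_iff two_ne_zero).1
      ⟨X * (X + y ^ 2), by rw [sq r, ← hr, hX4, hY4]; ring⟩
    have hXcop : IsCoprime X (X + y ^ 2) := by
      have h := (hcop.of_isCoprime_of_dvd_left ⟨4, by rw [hX4]; ring⟩ :
        IsCoprime X (y ^ 2)).add_mul_left_right 1
      rwa [mul_one, add_comm] at h
    rw [hX4, hY4] at hr
    obtain ⟨m, n, hm, hn, -⟩ := Int.exists_sq_and_sq_of_mul_eq_sq (c := c) hX0.le (by linarith)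
      hXcop (by linarith)
    rw [hn, hm] at hXcop
    refine ⟨n, m, y, z, ((IsCoprime.pow_iff two_pos two_pos).1 hXcop).symm, ?_, ?_, ?_, ?_, ?_⟩
    · have h : Even (m ^ 2) := by
        rw [← hm, hX, show i ^ 2 + i - j ^ 2 - j = i * (i + 1) - j * (j + 1) by ring]
        exact (Int.even_mul_succ_self i).sub (Int.even_mul_succ_self j)
      exact (Int.even_pow.1 h).1
    · rintro rfl
      simp [hm] at hX0
    · linarith
    · linarith
    · rw [mul_pow]
      nlinarith
  · have hc4 : IsCoprime (z ^ 2 - y ^ 2) (z ^ 2 + 3 * y ^ 2) := by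
      have h2 : IsCoprime (z ^ 2 - y ^ 2) 2 := ((Int.prime_two.coprime_iff_not_dvd).2 (by
        rwa [← even_iff_two_dvd, Int.not_even_iff_odd])).symm
      have h := ((h2.pow_right (n := 2)).mul_right hcop).add_mul_left_right 1
      rwa [show z ^ 2 + 3 * y ^ 2 = 2 ^ 2 * y ^ 2 + (z ^ 2 - y ^ 2) * 1 by ring]
    obtain ⟨a, b, ha, hb, -⟩ := Int.exists_sq_and_sq_of_mul_eq_sq (c := r) hpos.le (by nlinarith)
      hc4 (by rw [hr, sq])
    refine ⟨z, y, a, b, hzy, ?_, hy, ha.symm, hb.symm, ?_⟩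
    · by_contra hyo
      rw [Int.not_even_iff_odd] at hyo
      rcases Int.even_or_odd z with ⟨i, hi⟩ | hz
      · obtain ⟨j, hj⟩ := hyo
        rcases Int.even_or_odd a with ⟨k, hk⟩ | ⟨k, hk⟩ <;>
        rw [hi, hj, hk] at ha <;> ring_nf at ha <;> omega
      · exact Int.not_even_iff_odd.2 hodd (hz.pow.sub_odd hyo.pow)
    · rw [mul_pow]
      nlinarith

theorem not_sq_system {p q a b : ℤ} (hpq : IsCoprime p q) (hq : Even q) (hq0 : q ≠ 0)
    (ha : a ^ 2 = p ^ 2 - q ^ 2) (hb : b ^ 2 = p ^ 2 + 3 * q ^ 2) : False := by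
  induction h : q.natAbs using Nat.strong_induction_on generalizing p q a b with
  | _ N ih =>
    obtain ⟨y, z, hzy, hy, hpos, hlt, hsq⟩ := exists_smaller_of_sq_system hpq hq hq0 ha hb
    obtain ⟨p', q', a', b', hpq', hq', hq0', ha', hb', hle⟩ :=
      exists_sq_system_of_isSquare hzy hy hpos hsq
    exact ih q'.natAbs (h ▸ Int.natAbs_lt_iff_sq_lt.2 (hle.trans_lt hlt)) hpq' hq' hq0' ha' hb' rfl

/-- The elliptic curve `v ^ 2 = (x ^ 2 - 1) * (x ^ 2 + 3)` has no affine rational points besides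
`(±1, 0)`. -/
theorem Rat.sq_eq_one_of_isSquare {x : ℚ} (h : IsSquare ((x ^ 2 - 1) * (x ^ 2 + 3))) :
    x ^ 2 = 1 := by
  by_contra hx
  have hd : (x.den : ℚ) ≠ 0 := by exact_mod_cast x.den_ne_zero
  have hnum : (x.num : ℚ) = x * x.den := (Rat.mul_den_eq_num x).symm
  have hpos : 0 < x ^ 2 - 1 := by
    refine lt_of_le_of_ne ?_ (sub_ne_zero.2 hx).symm
    exact nonneg_of_mul_nonneg_left h.nonneg (by positivity)
  have hsq : IsSquare ((x.num ^ 2 - (x.den : ℤ) ^ 2) * (x.num ^ 2 + 3 * (x.den : ℤ) ^ 2)) := by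
    rw [← Rat.isSquare_intCast_iff]
    push_cast
    rw [hnum]
    obtain ⟨r, hr⟩ := h
    exact ⟨r * x.den ^ 2, by linear_combination (x.den : ℚ) ^ 4 * hr⟩
  have hpos' : 0 < x.num ^ 2 - (x.den : ℤ) ^ 2 := by
    have h : (0 : ℚ) < x.num ^ 2 - (x.den : ℚ) ^ 2 := by
      rw [hnum, show (x * x.den) ^ 2 - (x.den : ℚ) ^ 2 = (x ^ 2 - 1) * (x.den : ℚ) ^ 2 by ring]
      positivity
    exact_mod_cast h
  obtain ⟨p, q, a, b, hpq, hq, hq0, ha, hb, -⟩ := exists_sq_system_of_isSquare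
    (Rat.isCoprime_num_den x) (by exact_mod_cast x.den_ne_zero) hpos' hsq
  exact not_sq_system hpq hq hq0 ha hb

namespace WeierstrassCurve.Affine

variable {F : Type*} [Field F]

theorem isSquare_sub_of_duplication {α β γ x Y : F} (hY0 : Y ≠ 0)
    (hY : Y ^ 2 = (x - α) * (x - β) * (x - γ))
    (hdup : 4 * Y ^ 2 * (α - (α + β + γ) + 2 * x) =
      ((x - β) * (x - γ) + (x - α) * (x - γ) + (x - α) * (x - β)) ^ 2) :
    IsSquare (α - β) ∧ IsSquare (α - γ) := by
  have hd : x - α ≠ 0 := by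
    rintro h
    rw [h] at hY
    exact hY0 (by simpa using hY)
  have hAB : (x - α) ^ 2 = (α - β) * (α - γ) := by
    have h : ((x - α) ^ 2 - (α - β) * (α - γ)) ^ 2 = 0 := by
      linear_combination -hdup + 4 * (α - (α + β + γ) + 2 * x) * hY
    exact sub_eq_zero.1 (pow_eq_zero_iff two_ne_zero |>.1 h)
  have hsum : Y ^ 2 = (x - α) ^ 2 * (2 * (x - α) + (α - β) + (α - γ)) := by
    linear_combination hY - (x - α) * hAB
  constructor
  · refine ⟨(x - α) * (x - β) / Y, ?_⟩
    field_simp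
    linear_combination (α - β) * hsum - (x - α) ^ 2 * hAB
  · refine ⟨(x - α) * (x - γ) / Y, ?_⟩
    field_simp
    linear_combination (α - γ) * hsum - (x - α) ^ 2 * hAB

/-- If the two-torsion polynomial of `W` splits with roots `α`, `β`, `γ` and `W` has a point of
order four, then one of the roots differs from the two others by squares. -/
theorem isSquare_sub_of_addOrderOf_eq_four [DecidableEq F] (h2 : (2 : F) ≠ 0) {W : Affine F}
    {α β γ : F} (hb₂ : W.b₂ = -4 * (α + β + γ)) (hb₄ : W.b₄ = 2 * (α * β + α * γ + β * γ))
    (hb₆ : W.b₆ = -4 * (α * β * γ)) {P : W.Point} (hP : addOrderOf P = 4) :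
    (IsSquare (α - β) ∧ IsSquare (α - γ)) ∨ (IsSquare (β - α) ∧ IsSquare (β - γ)) ∨
      (IsSquare (γ - α) ∧ IsSquare (γ - β)) := by
  have h4 : (P + P) + (P + P) = 0 := by
    rw [← two_nsmul, ← two_nsmul, ← mul_nsmul, ← addOrderOf_dvd_iff_nsmul_eq_zero, hP]
  have hne : P + P ≠ 0 := by
    rw [← two_nsmul, ne_eq, ← addOrderOf_dvd_iff_nsmul_eq_zero, hP]
    decide
  rcases P with _ | ⟨x, y, h⟩
  · exact absurd (add_zero (0 : W.Point)) hne
  have hy : y ≠ W.negY x y := fun hy ↦ hne (Point.add_self_of_Y_eq hy)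
  rw [Point.add_self_of_Y_ne hy] at h4
  have hslope := slope_of_Y_ne (W := W) (rfl : x = x) hy
  have hns := nonsingular_add h h fun hxy => hy hxy.right
  set ℓ := W.slope x x y y
  have hy' : W.addY x x y ℓ = W.negY (W.addX x x ℓ) (W.addY x x y ℓ) := by
    by_contra hy'
    rw [Point.add_self_of_Y_ne hy'] at h4
    exact Point.some_ne_zero _ h4
  have heq' := (equation_iff _ _).1 hns.1
  have heq := (equation_iff _ _).1 h.1
  obtain ⟨x', hx'⟩ : ∃ x', x' = W.addX x x ℓ := ⟨_, rfl⟩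
  obtain ⟨y', hy''⟩ : ∃ y', y' = W.addY x x y ℓ := ⟨_, rfl⟩
  rw [← hx', ← hy''] at hy' heq'
  rw [negY] at hy'
  rw [addX] at hx'
  obtain ⟨Y, hY⟩ : ∃ Y, Y = y - W.negY x y := ⟨_, rfl⟩
  have hY0 : Y ≠ 0 := by rw [hY]; exact sub_ne_zero.2 hy
  rw [← hY, eq_div_iff hY0] at hslope
  rw [negY] at hY
  rw [b₂] at hb₂
  rw [b₄] at hb₄
  rw [b₆] at hb₆
  have h4' : (4 : F) ≠ 0 := by
    rw [show (4 : F) = 2 * 2 by norm_num]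
    exact mul_ne_zero h2 h2
  have hroot : (x' - α) * (x' - β) * (x' - γ) = 0 := by
    apply mul_left_cancel₀ h4'
    linear_combination -4 * heq' + (2 * y' + W.a₁ * x' + W.a₃) * hy' - x' ^ 2 * hb₂
      - 2 * x' * hb₄ - hb₆
  have hcurve : (Y / 2) ^ 2 = (x - α) * (x - β) * (x - γ) := by
    field_simp
    rw [hY]
    linear_combination 4 * heq + x ^ 2 * hb₂ + 2 * x * hb₄ + hb₆
  have hdup : 4 * (Y / 2) ^ 2 * (x' - (α + β + γ) + 2 * x) =
      ((x - β) * (x - γ) + (x - α) * (x - γ) + (x - α) * (x - β)) ^ 2 := by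
    have hfac : 2 * ((x - β) * (x - γ) + (x - α) * (x - γ) + (x - α) * (x - β)) =
        (2 * ℓ + W.a₁) * Y := by
      apply mul_left_cancel₀ h2
      rw [hY] at hslope ⊢
      linear_combination -4 * hslope - 2 * x * hb₂ - 2 * hb₄
    apply mul_left_cancel₀ h4'
    have hY2 : 4 * (Y / 2) ^ 2 = Y ^ 2 := by field_simp; norm_num
    rw [hY2]
    linear_combination 4 * Y ^ 2 * hx' - Y ^ 2 * hb₂ -
      (2 * ((x - β) * (x - γ) + (x - α) * (x - γ) + (x - α) * (x - β)) +
        (2 * ℓ + W.a₁) * Y) * hfac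
  rcases mul_eq_zero.1 hroot with h | h
  · rcases mul_eq_zero.1 h with h | h
    · rw [sub_eq_zero.1 h] at hdup
      exact .inl (isSquare_sub_of_duplication (div_ne_zero hY0 h2) hcurve hdup)
    · rw [sub_eq_zero.1 h] at hdup
      exact .inr (.inl (isSquare_sub_of_duplication (div_ne_zero hY0 h2)
        (by rw [hcurve]; ring) (by linear_combination hdup)))
  · rw [sub_eq_zero.1 h] at hdup
    exact .inr (.inr (isSquare_sub_of_duplication (div_ne_zero hY0 h2)
      (by rw [hcurve]; ring) (by linear_combination hdup)))

end WeierstrassCurve.Affine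

theorem add_eq_zero_of_isSquare_neg_of_isSquare {s t : ℚ} (ht : t ≠ 0)
    (h1 : IsSquare (-(t * (t + 2 * s)))) (h2 : IsSquare (s ^ 2 - t ^ 2)) : s + t = 0 := by
  obtain ⟨a, ha⟩ := h1
  obtain ⟨b, hb⟩ := h2
  have hx : (a / t) ^ 2 = -(1 + 2 * s / t) := by
    field_simp
    linear_combination -ha
  have h := Rat.sq_eq_one_of_isSquare (x := a / t) ⟨2 * b / t, by
    rw [hx]
    field_simp
    linear_combination 4 * hb⟩
  rw [hx] at h
  field_simp at h
  linarith

theorem eq_zero_of_isSquare_of_isSquare {s t : ℚ} (ht : t ≠ 0)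
    (h1 : IsSquare (t * (t + 2 * s))) (h2 : IsSquare (s * (s + 2 * t))) : s = 0 := by
  obtain ⟨a, ha⟩ := h1
  obtain ⟨b, hb⟩ := h2
  have hx : (a / t) ^ 2 = 1 + 2 * s / t := by
    field_simp
    linear_combination -ha
  have h := Rat.sq_eq_one_of_isSquare (x := a / t) ⟨2 * b / t, by
    rw [hx]
    field_simp
    linear_combination 4 * hb⟩
  rw [hx] at h
  field_simp at h
  linarith

/-- for `s, t ∈ ℚ` with `st ≠ 0`, `s ≠ t`, `s + t ≠ 0`, `t + 2s ≠ 0`,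
`s + 2t ≠ 0`, setting `k₁ = (t² + s² + ts)/(t + s)`, `k₂ = −ts/(t + s)`, `k₃ = t`, `k₄ = s`,
the Jacobian `E` of `v² = (k₁u+1)(k₂u+1)(k₃u+1)(k₄u+1)` has no rational point of order `4`. -/
theorem no_rational_four_torsion_family
    (s t : ℚ) (hst : s * t ≠ 0) (hne : s ≠ t) (hsum : s + t ≠ 0)
    (h1 : t + 2 * s ≠ 0) (h2 : s + 2 * t ≠ 0)
    (k₁ k₂ k₃ k₄ : ℚ)
    (hk₁ : k₁ = (t ^ 2 + s ^ 2 + t * s) / (t + s))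
    (hk₂ : k₂ = -(t * s) / (t + s))
    (hk₃ : k₃ = t) (hk₄ : k₄ = s)
    (W : WeierstrassCurve.Affine ℚ)
    (hW : W = { a₁ := k₁ + k₂ + k₃ + k₄,
                a₂ := (k₁ * k₂ + k₁ * k₃ + k₁ * k₄ + k₂ * k₃ + k₂ * k₄ + k₃ * k₄) -
                  (k₁ + k₂ + k₃ + k₄) ^ 2 / 4,
                a₃ := 2 * (k₁ * k₂ * k₃ + k₁ * k₂ * k₄ + k₁ * k₃ * k₄ + k₂ * k₃ * k₄),
                a₄ := -4 * (k₁ * k₂ * k₃ * k₄),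
                a₆ := ((k₁ * k₂ + k₁ * k₃ + k₁ * k₄ + k₂ * k₃ + k₂ * k₄ + k₃ * k₄) -
                  (k₁ + k₂ + k₃ + k₄) ^ 2 / 4) * (-4 * (k₁ * k₂ * k₃ * k₄)) })
    (hΔ : W.Δ ≠ 0) :
    ¬ ∃ P : W.Point, addOrderOf P = 4 := by
  rintro ⟨P, hP⟩
  have hs : s ≠ 0 := left_ne_zero_of_mul hst
  have ht : t ≠ 0 := right_ne_zero_of_mul hst
  have hw : t + s ≠ 0 := by rwa [add_comm]
  have descale : ∀ {c d e : ℚ}, c ≠ 0 → d = c ^ 2 * e → IsSquare d → IsSquare e := by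
    rintro c d e hc rfl ⟨r, hr⟩
    exact ⟨r / c, by field_simp; linear_combination hr⟩
  have hmain := WeierstrassCurve.Affine.isSquare_sub_of_addOrderOf_eq_four two_ne_zero
    (α := -(k₁ * k₂ + k₃ * k₄)) (β := -(k₁ * k₃ + k₂ * k₄)) (γ := -(k₁ * k₄ + k₂ * k₃))
    (by rw [hW, WeierstrassCurve.b₂]; ring) (by rw [hW, WeierstrassCurve.b₄]; ring)
    (by rw [hW, WeierstrassCurve.b₆]; ring) hP
  subst hk₁ hk₂ hk₃ hk₄
  rcases hmain with ⟨hA, hB⟩ | ⟨hA, hB⟩ | ⟨hA, hB⟩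
  · refine hs (eq_zero_of_isSquare_of_isSquare ht ?_ ?_)
    · exact descale (div_ne_zero ht hw) (by field_simp; ring) hA
    · exact descale (div_ne_zero hs hw) (by field_simp; ring) hB
  · refine hsum (add_eq_zero_of_isSquare_neg_of_isSquare ht ?_ ?_)
    · exact descale (div_ne_zero ht hw) (by field_simp; ring) hA
    · exact descale one_ne_zero (by field_simp; ring) hB
  · refine hw (add_eq_zero_of_isSquare_neg_of_isSquare hs ?_ ?_)
    · exact descale (div_ne_zero hs hw) (by field_simp; ring) hA
    · exact descale one_ne_zero (by field_simp; ring) hB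
end

section
/- The group of rational points of the elliptic curve E : y² = x³ − 4x² + 16x over ℚ is isomorphic to ℤ/4ℤ; in particular it is a cyclic group of order 4 (its Mordell–Weil rank is 0). -/
theorem isCoprime_sq_sub_sq_mul {a b : ℤ} (h : IsCoprime a b) :
    IsCoprime (a ^ 2 - b ^ 2) (a * b) := by
  refine .mul_right ?_ ?_
  · rw [show a ^ 2 - b ^ 2 = -b ^ 2 + a * a by ring]
    exact h.symm.pow_left.neg_left.add_mul_left_left a
  · rw [show a ^ 2 - b ^ 2 = a ^ 2 + b * -b by ring]
    exact h.pow_left.add_mul_left_left (-b)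

/-- The parametrization of coprime Pythagorean triples whose first leg is odd. -/
theorem exists_sq_sub_sq_of_sq_add_sq {x y z : ℤ} (h : x ^ 2 + y ^ 2 = z ^ 2)
    (hxy : IsCoprime x y) (hx : Odd x) :
    ∃ m n, x = m ^ 2 - n ^ 2 ∧ y = 2 * m * n ∧ IsCoprime m n := by
  have hz : z ≠ 0 := by
    rintro rfl
    have : x = 0 := by nlinarith [sq_nonneg x, sq_nonneg y]
    simp [this] at hx
  have ht : PythagoreanTriple x y |z| := by
    unfold PythagoreanTriple
    rw [abs_mul_abs_self]
    linarith
  obtain ⟨m, n, h1, h2, -, h3, -⟩ := ht.coprime_classification'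
    (Int.isCoprime_iff_gcd_eq_one.mp hxy) (Int.odd_iff.mp hx) (abs_pos.mpr hz)
  exact ⟨m, n, h1, h2, Int.isCoprime_iff_gcd_eq_one.mpr h3⟩

theorem three_dvd_of_three_dvd_sq_add_sq {p s : ℤ} (h : 3 ∣ p ^ 2 + s ^ 2) : 3 ∣ p ∧ 3 ∣ s := by
  have hp : p % 3 = 0 ∨ p % 3 = 1 ∨ p % 3 = 2 := by lia
  have hs : s % 3 = 0 ∨ s % 3 = 1 ∨ s % 3 = 2 := by lia
  have h' := Int.emod_eq_zero_of_dvd h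
  rcases hp with hp | hp | hp <;> rcases hs with hs | hs | hs <;>
    first
    | exact ⟨Int.dvd_of_emod_eq_zero hp, Int.dvd_of_emod_eq_zero hs⟩
    | simp [pow_two, Int.add_emod, Int.mul_emod, hp, hs] at h'

theorem not_odd_of_sq_add_sq_eq_sq {p q s : ℤ} (h : q ^ 2 = p ^ 2 + s ^ 2) (hs : Odd s) :
    ¬ Odd p := by
  rintro ⟨k, rfl⟩
  obtain ⟨l, rfl⟩ := hs
  rcases Int.even_or_odd' q with ⟨t, rfl | rfl⟩
  · have : 4 * (t ^ 2 - k ^ 2 - k - l ^ 2 - l) = 2 := by linarith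
    lia
  · have : 2 * (2 * (t ^ 2 + t - k ^ 2 - k - l ^ 2 - l)) = 1 := by linarith
    lia

/-- The homogeneous system met in the descent: `3` is the only possible common factor. -/
theorem sq_eq_of_sq_mul_eq_sq_mul {p q r s : ℤ} (hps : IsCoprime p s) (hqr : IsCoprime q r)
    (hq : q ≠ 0) (hs : s ≠ 0)
    (h : p ^ 2 * (4 * q ^ 2 - r ^ 2) = s ^ 2 * (r ^ 2 - q ^ 2)) :
    q ^ 2 = p ^ 2 + s ^ 2 ∧ r ^ 2 = s ^ 2 + (2 * p) ^ 2 := by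
  have hd : s ^ 2 ∣ 4 * q ^ 2 - r ^ 2 :=
    (IsCoprime.pow hps.symm).dvd_of_dvd_mul_left (Dvd.intro _ h.symm)
  obtain ⟨k, hk⟩ := hd
  have hk' : r ^ 2 - q ^ 2 = p ^ 2 * k := by
    refine mul_left_cancel₀ (pow_ne_zero 2 hs) ?_
    rw [← h, hk]; ring
  have hsum : 3 * q ^ 2 = k * (p ^ 2 + s ^ 2) := by linear_combination hk + hk'
  have h3k : (3 : ℤ) ∣ k := by
    refine (Int.prime_three.dvd_or_dvd (Dvd.intro _ hsum)).resolve_right fun h3 => ?_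
    obtain ⟨h3p, h3s⟩ := three_dvd_of_three_dvd_sq_add_sq h3
    have := hps.isUnit_of_dvd' h3p h3s
    rw [Int.isUnit_iff] at this
    lia
  obtain ⟨l, rfl⟩ := h3k
  have hql : q ^ 2 = l * (p ^ 2 + s ^ 2) := by linarith
  have hrl : r ^ 2 = l * (s ^ 2 + (2 * p) ^ 2) := by linarith
  have hl : IsUnit l :=
    (IsCoprime.pow hqr).isUnit_of_dvd' (Dvd.intro _ hql.symm) (Dvd.intro _ hrl.symm)
  rcases Int.isUnit_iff.mp hl with rfl | rfl
  · exact ⟨by linarith, by linarith⟩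
  · have := pow_pos (abs_pos.mpr hq) 2
    rw [sq_abs] at this
    nlinarith [sq_nonneg p, sq_nonneg s]

/-- One descent step for `a ^ 4 - a ^ 2 * b ^ 2 + b ^ 4 = c ^ 2` with `a` even. -/
theorem quartic_descent {a b c : ℤ} (hab : IsCoprime a b) (ha : Even a) (ha0 : a ≠ 0)
    (h : a ^ 4 - a ^ 2 * b ^ 2 + b ^ 4 = c ^ 2) :
    ∃ u v w : ℤ, IsCoprime u v ∧ Even (u * v) ∧ u * v ≠ 0 ∧
      u ^ 4 - u ^ 2 * v ^ 2 + v ^ 4 = w ^ 2 ∧ (u * v).natAbs < (a * b).natAbs := by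
  have hb : Odd b := by
    rw [← Int.not_even_iff_odd]
    intro hb
    have := hab.isUnit_of_dvd' ha.two_dvd hb.two_dvd
    rw [Int.isUnit_iff] at this
    lia
  have hb0 : b ≠ 0 := by rintro rfl; simp at hb
  obtain ⟨m, n, h1, h2, hmn⟩ := exists_sq_sub_sq_of_sq_add_sq (z := c)
    (by linear_combination h) (isCoprime_sq_sub_sq_mul hab)
    ((ha.pow_of_ne_zero two_ne_zero).sub_odd hb.pow)
  obtain ⟨a', rfl⟩ := ha.two_dvd
  have hmn' : a' * b = m * n := by linarith
  obtain ⟨p, q, ⟨r, rfl⟩, ⟨s, rfl⟩, rfl⟩ := exists_dvd_and_dvd_of_dvd_mul (Dvd.intro _ hmn')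
  have hpq : p * q ≠ 0 := by simpa using ha0
  have hp : p ≠ 0 := left_ne_zero_of_mul hpq
  have hq : q ≠ 0 := right_ne_zero_of_mul hpq
  obtain rfl : b = r * s := mul_left_cancel₀ hpq (by linarith)
  have hr : r ≠ 0 := left_ne_zero_of_mul hb0
  have hs : s ≠ 0 := right_ne_zero_of_mul hb0
  have hps : IsCoprime p s := hmn.of_mul_left_left.of_mul_right_right
  have hqr : IsCoprime q r := hmn.of_mul_left_right.of_mul_right_left.symm
  obtain ⟨hq2, hr2⟩ := sq_eq_of_sq_mul_eq_sq_mul hps hqr hq hs (by linear_combination h1)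
  have hso : Odd s := (Int.odd_mul.mp hb).2
  have hpe : Even p := Int.not_odd_iff_even.mp (not_odd_of_sq_add_sq_eq_sq hq2 hso)
  have hs2 : IsCoprime s 2 := by
    obtain ⟨t, rfl⟩ := hso
    exact ⟨1, -t, by ring⟩
  obtain ⟨u, v, hu, hv, huv⟩ := exists_sq_sub_sq_of_sq_add_sq hr2.symm
    (hs2.mul_right hps.symm) hso
  obtain rfl : p = u * v := by linarith
  refine ⟨u, v, q, huv, hpe, hp, ?_, ?_⟩
  · rw [hq2, hu]; ring
  · have e : 2 * (u * v * q) * (r * s) = u * v * (2 * (q * r * s)) := by ring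
    rw [e, Int.natAbs_mul (u * v), Int.natAbs_mul 2]
    have h1 : 0 < (u * v).natAbs := Int.natAbs_pos.mpr hp
    have h2 : 0 < (q * r * s).natAbs :=
      Int.natAbs_pos.mpr (mul_ne_zero (mul_ne_zero hq hr) hs)
    exact lt_mul_of_one_lt_right h1 (by simp only [Int.reduceAbs]; lia)

theorem mul_eq_zero_of_quartic_of_even {a b c : ℤ} (hab : IsCoprime a b) (he : Even (a * b))
    (h : a ^ 4 - a ^ 2 * b ^ 2 + b ^ 4 = c ^ 2) : a * b = 0 := by
  induction hN : (a * b).natAbs using Nat.strong_induction_on generalizing a b c with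
  | _ N ih =>
    subst hN
    by_contra h0
    have ha0 := left_ne_zero_of_mul h0
    have hb0 := right_ne_zero_of_mul h0
    obtain ⟨u, v, w, huv, hev, hne, hw, hlt⟩ : ∃ u v w : ℤ, IsCoprime u v ∧ Even (u * v) ∧
        u * v ≠ 0 ∧ u ^ 4 - u ^ 2 * v ^ 2 + v ^ 4 = w ^ 2 ∧
        (u * v).natAbs < (a * b).natAbs := by
      rcases Int.even_mul.mp he with ha | hb
      · exact quartic_descent hab ha ha0 h
      · rw [mul_comm a b]
        exact quartic_descent (c := c) hab.symm hb hb0 (by linarith)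
    exact hne (ih _ hlt huv hev hw rfl)

/-- The coprime integral solutions of `a ^ 4 - a ^ 2 * b ^ 2 + b ^ 4 = c ^ 2` are trivial. -/
theorem mul_eq_zero_or_sq_eq_sq_of_quartic {a b c : ℤ} (hab : IsCoprime a b)
    (h : a ^ 4 - a ^ 2 * b ^ 2 + b ^ 4 = c ^ 2) : a * b = 0 ∨ a ^ 2 = b ^ 2 := by
  rcases Int.even_or_odd (a * b) with he | ho
  · exact .inl (mul_eq_zero_of_quartic_of_even hab he h)
  right
  obtain ⟨m, n, h1, h2, hmn⟩ := exists_sq_sub_sq_of_sq_add_sq (z := c)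
    (by linear_combination h) (isCoprime_sq_sub_sq_mul hab).symm ho
  have hmne : Even (m * n) := by
    rw [h1, Int.odd_sub, Int.odd_pow' two_ne_zero, Int.even_pow' two_ne_zero] at ho
    rw [Int.even_mul, ← Int.not_odd_iff_even, ho]
    exact (em _).symm
  obtain ⟨ha, hb⟩ := Int.odd_mul.mp ho
  obtain ⟨d, hd⟩ := (ha.pow (n := 2)).add_odd (hb.pow (n := 2))
  have hmn0 := mul_eq_zero_of_quartic_of_even hmn hmne (c := d) <| by
    have h3 : (a ^ 2 + b ^ 2) ^ 2 = (a ^ 2 - b ^ 2) ^ 2 + 4 * (a * b) ^ 2 := by ring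
    rw [h2, h1, hd] at h3
    linarith
  rw [mul_assoc, hmn0] at h2
  linarith

theorem isSquare_int_of_isCoprime_of_pos {a b c : ℤ} (h : IsCoprime a b) (ha : 0 < a)
    (heq : a * b = c ^ 2) : ∃ d, a = d ^ 2 := by
  obtain ⟨d, hd | hd⟩ := Int.sq_of_isCoprime h heq
  · exact ⟨d, hd⟩
  · nlinarith [sq_nonneg d]

/-- The rational points of `y ^ 2 = x ^ 3 - x ^ 2 + x` have abscissa `0` or `1`. -/
theorem eq_zero_or_eq_one_of_sq_eq_cubic {x y : ℚ} (h : y ^ 2 = x ^ 3 - x ^ 2 + x) :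
    x = 0 ∨ x = 1 := by
  by_cases hx0 : x = 0
  · exact .inl hx0
  right
  have hxpos : 0 < x := by
    have : 0 < x ^ 2 - x + 1 := by nlinarith [sq_nonneg (2 * x - 1)]
    have h' : y ^ 2 = x * (x ^ 2 - x + 1) := by rw [h]; ring
    exact lt_of_le_of_ne (nonneg_of_mul_nonneg_left (h' ▸ sq_nonneg y) this) (Ne.symm hx0)
  set n : ℤ := x.num with hn
  set d : ℤ := (x.den : ℤ) with hd
  have hnpos : 0 < n := Rat.num_pos.mpr hxpos
  have hdpos : 0 < d := by simp [hd, x.den_pos]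
  have hdQ : (d : ℚ) ≠ 0 := by exact_mod_cast hdpos.ne'
  have hnd : IsCoprime n d := by
    rw [Int.isCoprime_iff_nat_coprime]
    simpa [hd] using x.reduced
  have hx : x = n / d := by simp [hn, hd, Rat.num_div_den]
  have hq : (y * d ^ 2) ^ 2 = ((n * (d * (n ^ 2 - n * d + d ^ 2)) : ℤ) : ℚ) := by
    rw [mul_pow, h, hx]
    push_cast
    field_simp
  obtain ⟨c, hc⟩ : ∃ c : ℤ, n * (d * (n ^ 2 - n * d + d ^ 2)) = c ^ 2 := by
    have : IsSquare ((n * (d * (n ^ 2 - n * d + d ^ 2)) : ℤ) : ℚ) := ⟨y * d ^ 2, by rw [← hq, sq]⟩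
    obtain ⟨c, hc⟩ := Rat.isSquare_intCast_iff.mp this
    exact ⟨c, by rw [hc, sq]⟩
  have hqpos : 0 < n ^ 2 - n * d + d ^ 2 := by nlinarith [sq_nonneg (n - d), mul_pos hnpos hdpos]
  have hnq : IsCoprime n (n ^ 2 - n * d + d ^ 2) := by
    rw [show n ^ 2 - n * d + d ^ 2 = d ^ 2 + n * (n - d) by ring]
    exact hnd.pow_right.add_mul_left_right (n - d)
  have hdq : IsCoprime d (n ^ 2 - n * d + d ^ 2) := by
    rw [show n ^ 2 - n * d + d ^ 2 = n ^ 2 + d * (d - n) by ring]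
    exact hnd.symm.pow_right.add_mul_left_right (d - n)
  obtain ⟨a, ha⟩ := isSquare_int_of_isCoprime_of_pos (hnd.mul_right hnq) hnpos hc
  obtain ⟨b, hb⟩ := isSquare_int_of_isCoprime_of_pos (hnd.symm.mul_right hdq) hdpos
    (show d * (n * (n ^ 2 - n * d + d ^ 2)) = c ^ 2 by rw [← hc]; ring)
  obtain ⟨e, he⟩ := isSquare_int_of_isCoprime_of_pos (hnq.mul_left hdq).symm hqpos
    (show (n ^ 2 - n * d + d ^ 2) * (n * d) = c ^ 2 by rw [← hc]; ring)
  have hab : IsCoprime a b := by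
    rw [ha, hb] at hnd
    exact (IsCoprime.pow_iff two_pos two_pos).mp hnd
  rw [ha, hb] at he
  rcases mul_eq_zero_or_sq_eq_sq_of_quartic hab (c := e) (by linarith) with h0 | h0
  · rcases mul_eq_zero.mp h0 with rfl | rfl
    · simp [ha] at hnpos
    · simp [hb] at hdpos
  · rw [hx, ha, hb, h0, div_self]
    rw [← hb]; exact hdQ

/-- The affine rational points of `y ^ 2 = x ^ 3 - 4 * x ^ 2 + 16 * x`. -/
theorem eq_of_sq_eq_cubic {x y : ℚ} (h : y ^ 2 = x ^ 3 - 4 * x ^ 2 + 16 * x) :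
    x = 0 ∧ y = 0 ∨ x = 4 ∧ y = 8 ∨ x = 4 ∧ y = -8 := by
  rcases eq_zero_or_eq_one_of_sq_eq_cubic (x := x / 4) (y := y / 8)
    (by linear_combination h / 64) with hx | hx
  · obtain rfl : x = 0 := by linarith
    exact .inl ⟨rfl, by simpa using h⟩
  · obtain rfl : x = 4 := by linarith
    have : (y - 8) * (y + 8) = 0 := by linear_combination h
    rcases mul_eq_zero.mp this with hy | hy
    · exact .inr (.inl ⟨rfl, by linarith⟩)
    · exact .inr (.inr ⟨rfl, by linarith⟩)

/-- the group of rational points of the elliptic curve `y² = x³ − 4x² + 16x`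
over `ℚ` is isomorphic to `ℤ/4ℤ`. -/
theorem mordell_weil_x3_sub_4x2_add_16x
    (W : WeierstrassCurve.Affine ℚ)
    (hW : W = { a₁ := 0, a₂ := -4, a₃ := 0, a₄ := 16, a₆ := 0 }) :
    Nonempty (W.Point ≃+ ZMod 4) := by
  have hP : W.Nonsingular 4 8 := by
    subst hW
    rw [WeierstrassCurve.Affine.nonsingular_iff, WeierstrassCurve.Affine.equation_iff]
    norm_num
  have hT : W.Nonsingular 0 0 := by
    subst hW
    rw [WeierstrassCurve.Affine.nonsingular_iff, WeierstrassCurve.Affine.equation_iff]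
    norm_num
  let P : W.Point := .some 4 8 hP
  have h2P : P + P = .some 0 0 hT := by
    have hy : (8 : ℚ) ≠ W.negY 4 8 := by subst hW; norm_num [WeierstrassCurve.Affine.negY]
    have hs : W.slope 4 4 8 8 = 2 := by
      rw [WeierstrassCurve.Affine.slope_of_Y_ne rfl hy]
      subst hW
      norm_num [WeierstrassCurve.Affine.negY]
    rw [WeierstrassCurve.Affine.Point.add_self_of_Y_ne hy]
    simp only [WeierstrassCurve.Affine.Point.some.injEq, hs]
    subst hW
    norm_num [WeierstrassCurve.Affine.addX, WeierstrassCurve.Affine.addY,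
      WeierstrassCurve.Affine.negAddY, WeierstrassCurve.Affine.negY]
  have h4P : (2 ^ 2) • P = 0 := by
    rw [pow_two, mul_nsmul, two_nsmul, two_nsmul, h2P]
    refine WeierstrassCurve.Affine.Point.add_self_of_Y_eq ?_
    subst hW
    norm_num [WeierstrassCurve.Affine.negY]
  have hgen : ∀ Q : W.Point, Q ∈ AddSubgroup.zmultiples P := by
    rintro (_ | ⟨x, y, hQ⟩)
    · exact zero_mem _
    have hQ' : y ^ 2 = x ^ 3 - 4 * x ^ 2 + 16 * x := by
      have := hQ.1
      rw [WeierstrassCurve.Affine.equation_iff] at this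
      subst hW
      linear_combination this
    rcases eq_of_sq_eq_cubic hQ' with ⟨rfl, rfl⟩ | ⟨rfl, rfl⟩ | ⟨rfl, rfl⟩
    · rw [← h2P]
      exact add_mem (AddSubgroup.mem_zmultiples P) (AddSubgroup.mem_zmultiples P)
    · exact AddSubgroup.mem_zmultiples P
    · convert neg_mem (AddSubgroup.mem_zmultiples P) using 1
      simp only [P, WeierstrassCurve.Affine.Point.neg_some,
        WeierstrassCurve.Affine.Point.some.injEq, true_and]
      subst hW
      norm_num [WeierstrassCurve.Affine.negY]
  have hcard : Nat.card W.Point = 4 := by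
    have : addOrderOf P = 2 ^ (1 + 1) := by
      refine addOrderOf_eq_prime_pow ?_ h4P
      rw [pow_one, two_nsmul, h2P]
      exact WeierstrassCurve.Affine.Point.some_ne_zero hT
    rw [← addOrderOf_eq_card_of_forall_mem_zmultiples hgen, this]
    rfl
  exact ⟨(zmodAddEquivOfGenerator hgen hcard).symm⟩
end
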